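/- arXiv:2011.06586 — 2 statements merged into one kernel-verified Lean document; each statement's English description precedes it below -/
import Mathlib

section
/- There exist constants C > 0 and X0 ≥ 3 such that for all X ≥ X0 one has |Σ (x21*x22*x31*x32 / x11) * (x11*x12*x31*x32 / x21) * (x11*x12*x21*x22 / x31)| ≤ C * X * (log X)^(15/8), where the sum ranges over all 6-tuples (x11, x12, x21, x22, x31, x32) of positive integers such that the product x11*x12*x21*x22*x31*x32 is squarefree and at most X, and such that x_{i1} > 1 and x_{i2} > 1 for each i = 1, 2, 3. -/
open Real

/-- The Jacobi symbol of two natural numbers as a real number. -/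
noncomputable def jac (a b : ℕ) : ℝ := ((jacobiSym (a : ℤ) b : ℤ) : ℝ)

lemma jac_mul_left (a b c : ℕ) : jac (a * b) c = jac a c * jac b c := by
  simp [jac, jacobiSym.mul_left]

lemma jac_mul_right (a : ℕ) {b c : ℕ} (hb : b ≠ 0) (hc : c ≠ 0) :
    jac a (b * c) = jac a b * jac a c := by
  simp [jac, jacobiSym.mul_right' _ hb hc]

lemma jac_eq_zero_or_one_or_neg_one (a b : ℕ) : jac a b = 0 ∨ jac a b = 1 ∨ jac a b = -1 := by
  unfold jac
  rcases jacobiSym.trichotomy (a : ℤ) b with h | h | h <;> simp [h]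

lemma abs_jac_le_one (a b : ℕ) : |jac a b| ≤ 1 := by
  rcases jac_eq_zero_or_one_or_neg_one a b with h | h | h <;> simp [h]

lemma jac_eq_zero {a b : ℕ} (hb : b ≠ 0) (h : ¬ a.Coprime b) : jac a b = 0 := by
  have : jacobiSym (a : ℤ) b = 0 := jacobiSym.eq_zero_iff.2 ⟨hb, by simpa using h⟩
  simp [jac, this]

lemma jac_mul_self {a b : ℕ} (h : a.Coprime b) : jac a b * jac a b = 1 := by
  have h1 : jacobiSym (a : ℤ) b ≠ 0 := jacobiSym.ne_zero (by simpa using h)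
  rcases jacobiSym.trichotomy (a : ℤ) b with h | h | h
  · exact absurd h h1
  · simp [jac, h]
  · simp [jac, h]

lemma jac_congr_left {a a' b : ℕ} (h : a ≡ a' [MOD b]) : jac a b = jac a' b := by
  unfold jac
  rw [jacobiSym.mod_left' (a₁ := (a : ℤ)) (a₂ := (a' : ℤ))]
  exact_mod_cast h

lemma jac_congr_right {a b b' : ℕ} (hb : Odd b) (hb' : Odd b') (h : b ≡ b' [MOD 4 * a]) :
    jac a b = jac a b' := by
  unfold jac
  rw [jacobiSym.mod_right _ hb, jacobiSym.mod_right _ hb']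
  simp only [Int.natAbs_natCast]
  rw [h]

lemma jac_one_left (b : ℕ) : jac 1 b = 1 := by simp [jac, jacobiSym.one_left]

lemma jac_one_right (a : ℕ) : jac a 1 = 1 := by simp [jac]

/-- A completely multiplicative function bounded by one whose partial sums are bounded by `B`. -/
structure IsOscillating (f : ℕ → ℝ) (B : ℝ) : Prop where
  map_mul : ∀ x y, f (x * y) = f x * f y
  abs_le_one : ∀ x, |f x| ≤ 1
  abs_sum_le : ∀ Z : ℕ, |∑ x ∈ Finset.Icc 1 Z, f x| ≤ B

lemma sum_range_eq_zero_of_periodic {f : ℕ → ℝ} {Q : ℕ} (hQ : 0 < Q)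
    (hmul : ∀ x y, f (x * y) = f x * f y) (hper : ∀ x y, x ≡ y [MOD Q] → f x = f y)
    {a : ℕ} (ha : a.Coprime Q) (hfa : f a = -1) : ∑ x ∈ Finset.range Q, f x = 0 := by
  have : NeZero Q := ⟨hQ.ne'⟩
  have h1 : ∑ x ∈ Finset.range Q, f x = ∑ u : ZMod Q, f u.val := by
    refine Finset.sum_bij' (fun x _ => (x : ZMod Q)) (fun u _ => u.val) ?_ ?_ ?_ ?_ ?_
    · simp
    · intro u _; simpa using ZMod.val_lt u
    · intro x hx; simp at hx; exact ZMod.val_cast_of_lt hx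
    · intro u _; simp
    · intro x hx; simp at hx; rw [ZMod.val_cast_of_lt hx]
  have h2 : ∑ u : ZMod Q, f u.val = ∑ u : ZMod Q, f ((ZMod.unitOfCoprime a ha : ZMod Q) * u).val :=
    (Equiv.sum_comp (Units.mulLeft (ZMod.unitOfCoprime a ha)) (fun u : ZMod Q => f u.val)).symm
  have h3 : ∀ u : ZMod Q, f ((ZMod.unitOfCoprime a ha : ZMod Q) * u).val = - f u.val := by
    intro u
    rw [← neg_one_mul, ← hfa, ← hmul]
    apply hper
    rw [← ZMod.natCast_eq_natCast_iff]
    simp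
  rw [h1]
  simp only [h3, Finset.sum_neg_distrib] at h2
  linarith

lemma IsOscillating.of_periodic {f : ℕ → ℝ} {Q : ℕ} (hQ : 0 < Q)
    (hmul : ∀ x y, f (x * y) = f x * f y) (hbd : ∀ x, |f x| ≤ 1)
    (hper : ∀ x y, x ≡ y [MOD Q] → f x = f y)
    {a : ℕ} (ha : a.Coprime Q) (hfa : f a = -1) : IsOscillating f Q := by
  refine ⟨hmul, hbd, fun Z => ?_⟩
  have h0 : f 0 = 0 := by
    have := hmul 0 a
    rw [hfa, zero_mul] at this
    linarith
  have hs := sum_range_eq_zero_of_periodic hQ hmul hper ha hfa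
  have key : ∀ n : ℕ, |∑ x ∈ Finset.range n, f x| ≤ Q := by
    intro n
    induction n using Nat.strong_induction_on with
    | _ n ih =>
      rcases lt_or_ge n Q with h | h
      · calc |∑ x ∈ Finset.range n, f x| ≤ ∑ x ∈ Finset.range n, |f x| :=
              Finset.abs_sum_le_sum_abs _ _
          _ ≤ ∑ x ∈ Finset.range n, (1 : ℝ) := Finset.sum_le_sum fun x _ => hbd x
          _ = n := by simp
          _ ≤ Q := by exact_mod_cast h.le
      · obtain ⟨k, rfl⟩ := Nat.exists_eq_add_of_le h
        rw [Finset.sum_range_add, hs, zero_add]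
        rw [Finset.sum_congr rfl (fun x _ => hper (Q + x) x (by simp [Nat.ModEq]))]
        exact ih k (by omega)
  have : ∑ x ∈ Finset.Icc 1 Z, f x = ∑ x ∈ Finset.range (Z + 1), f x := by
    rw [Finset.sum_range_succ', h0, add_zero, Finset.range_eq_Ico, Finset.sum_Ico_add' f 0 Z 1]
    rfl
  rw [this]
  exact key _

lemma exists_jac_eq_neg_one {p r : ℕ} (hp : p.Prime) (hp2 : p ≠ 2) (hr : 0 < r) (hpr : ¬ p ∣ r) :
    ∃ a, a ≡ 1 [MOD 8] ∧ a.Coprime (8 * (p * r)) ∧ jac a (p * r) = -1 ∧ jac (p * r) a = -1 := by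
  have : Fact p.Prime := ⟨hp⟩
  have hodd : Odd p := hp.odd_of_ne_two hp2
  obtain ⟨g, hg⟩ : ∃ g : ZMod p, quadraticChar (ZMod p) g = -1 :=
    quadraticChar_exists_neg_one (by rw [ZMod.ringChar_zmod_n]; exact hp2)
  have hcop : p.Coprime (8 * r) := by
    refine Nat.Coprime.mul_right ?_ ((Nat.Prime.coprime_iff_not_dvd hp).2 hpr)
    have : Nat.Coprime p 2 := (Nat.coprime_primes hp Nat.prime_two).2 hp2
    exact Nat.Coprime.pow_right 3 this
  obtain ⟨a, ha1, ha2⟩ := Nat.chineseRemainder hcop g.val 1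
  have ha8 : a ≡ 1 [MOD 8] := ha2.of_mul_right r
  have har : a ≡ 1 [MOD r] := ha2.of_mul_left 8
  have haodd : Odd a := by
    have : a % 8 = 1 := ha8
    rw [Nat.odd_iff]; omega
  have ha4 : a % 4 = 1 := by
    have : a % 8 = 1 := ha8
    omega
  have hjp : jac a p = -1 := by
    rw [jac_congr_left ha1, jac, ← jacobiSym.legendreSym.to_jacobiSym, legendreSym]
    simp [hg]
  have hjr : jac a r = 1 := by rw [jac_congr_left har, jac_one_left]
  have hjp' : jac p a = -1 := by
    rw [← hjp, jac, jac, jacobiSym.quadratic_reciprocity_one_mod_four ha4 hodd]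
  have hjr' : jac r a = 1 := by
    rw [jac_congr_right haodd odd_one, jac_one_right]
    exact ha2.of_dvd (Nat.mul_dvd_mul_right (by norm_num) r)
  refine ⟨a, ha8, ?_, ?_, ?_⟩
  · have e1 : a.Coprime (8 * r) := by
      have := ha2.gcd_eq
      simpa using this
    have e2 : a.Coprime p := by
      by_contra h
      rw [jac_eq_zero hp.pos.ne' h] at hjp
      norm_num at hjp
    have : 8 * (p * r) = p * (8 * r) := by ring
    rw [this]
    exact e2.mul_right e1
  · rw [jac_mul_right _ hp.pos.ne' hr.ne', hjp, hjr]; norm_num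
  · rw [jac_mul_left, hjp', hjr']; norm_num

/-- `q` has an odd prime factor occurring to the first power. -/
def HasSimpleOddPrime (q : ℕ) : Prop :=
  ∃ p r : ℕ, p.Prime ∧ p ≠ 2 ∧ 0 < r ∧ ¬ p ∣ r ∧ q = p * r

lemma HasSimpleOddPrime.isOscillating_numerator {q : ℕ} (h : HasSimpleOddPrime q) :
    IsOscillating (fun x => jac x q) q := by
  obtain ⟨p, r, hp, hp2, hr, hpr, rfl⟩ := h
  obtain ⟨a, -, h2, h3, -⟩ := exists_jac_eq_neg_one hp hp2 hr hpr
  exact IsOscillating.of_periodic (Nat.mul_pos hp.pos hr) (fun x y => jac_mul_left x y _)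
    (fun x => abs_jac_le_one x _) (fun x y hxy => jac_congr_left hxy)
    (h2.coprime_dvd_right (Dvd.intro_left _ rfl)) h3

open Classical in
lemma HasSimpleOddPrime.isOscillating_denominator {q : ℕ} (h : HasSimpleOddPrime q) {χ : ℕ → ℝ}
    (hmul : ∀ x y, χ (x * y) = χ x * χ y) (hbd : ∀ x, |χ x| ≤ 1)
    (hper : ∀ x y, x ≡ y [MOD 8] → χ x = χ y) (hone : χ 1 = 1) :
    IsOscillating (fun x => if Odd x then χ x * jac q x else 0) (8 * q : ℕ) := by
  obtain ⟨p, r, hp, hp2, hr, hpr, rfl⟩ := h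
  obtain ⟨a, h1, h2, -, h4⟩ := exists_jac_eq_neg_one hp hp2 hr hpr
  refine IsOscillating.of_periodic (by have := Nat.mul_pos hp.pos hr; omega) ?_ ?_ ?_ h2 ?_
  · intro x y
    by_cases hx : Odd x
    · by_cases hy : Odd y
      · have hx0 : x ≠ 0 := by rintro rfl; simp at hx
        have hy0 : y ≠ 0 := by rintro rfl; simp at hy
        simp only [hx, hy, hx.mul hy, if_true, hmul, jac_mul_right _ hx0 hy0]
        ring
      · simp [Nat.odd_mul, hy]
    · simp [Nat.odd_mul, hx]
  · intro x
    split_ifs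
    · rw [abs_mul]
      exact mul_le_one₀ (hbd x) (abs_nonneg _) (abs_jac_le_one _ _)
    · simp
  · intro x y hxy
    have e : x ≡ y [MOD 2] := hxy.of_dvd ⟨4 * (p * r), by ring⟩
    have e' : Odd x ↔ Odd y := by rw [Nat.odd_iff, Nat.odd_iff, e]
    by_cases hx : Odd x
    · have hy := e'.1 hx
      simp only [hx, hy, if_true]
      rw [hper x y (hxy.of_mul_right _),
        jac_congr_right hx hy (hxy.of_dvd (Nat.mul_dvd_mul_right (by norm_num) _))]
    · have hy : ¬ Odd y := fun h => hx (e'.2 h)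
      simp only [hx, hy, if_false]
  · have : Odd a := by
      have : a % 8 = 1 := h1
      rw [Nat.odd_iff]; omega
    simp only [this, if_true]
    rw [hper a 1 h1, hone, h4, one_mul]

lemma hasSimpleOddPrime_mul {m n : ℕ} (hm : Squarefree m) (hn : Squarefree n)
    (h1 : m ≠ n) (h2 : m ≠ 2 * n) (h3 : n ≠ 2 * m) : HasSimpleOddPrime (m * n) := by
  have hm0 := hm.ne_zero
  have hn0 := hn.ne_zero
  by_contra hcon
  have aux : ∀ {m n : ℕ}, Squarefree m → n ≠ 0 → ¬ HasSimpleOddPrime (m * n) →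
      ∀ p : ℕ, p.Prime → p ≠ 2 → p ∣ m → p ∣ n := by
    intro m n hm hn0 hcon p hp hp2 hpm
    by_contra hpn
    obtain ⟨k, rfl⟩ := hpm
    have hk : ¬ p ∣ k := by
      rintro ⟨l, rfl⟩
      have := hm p ⟨l, by ring⟩
      exact hp.one_lt.ne' (Nat.isUnit_iff.1 this)
    have hk0 : k ≠ 0 := by rintro rfl; simp at hk
    refine hcon ⟨p, k * n, hp, hp2, Nat.pos_of_ne_zero (mul_ne_zero hk0 hn0), ?_, by ring⟩
    rw [hp.dvd_mul]; tauto
  have a1 := aux hm hn0 hcon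
  have a2 := aux hn hm0 (by rwa [mul_comm])
  have hdvd : ∀ {m n : ℕ}, Squarefree m → n ≠ 0 →
      (∀ p : ℕ, p.Prime → p ≠ 2 → p ∣ m → p ∣ n) → (2 ∣ m → 2 ∣ n) → m ∣ n := by
    intro m n hm hn0 h h2
    rw [← Nat.prod_primeFactors_of_squarefree hm]
    refine (Finset.prod_dvd_prod_of_subset _ _ _ fun p hp => ?_).trans (Nat.prod_primeFactors_dvd n)
    have hp' := Nat.prime_of_mem_primeFactors hp
    have hpm := Nat.dvd_of_mem_primeFactors hp
    refine Nat.mem_primeFactors.2 ⟨hp', ?_, hn0⟩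
    rcases eq_or_ne p 2 with rfl | hp2
    · exact h2 hpm
    · exact h p hp' hp2 hpm
  have double : ∀ {m n : ℕ}, Squarefree m → Squarefree n →
      (∀ p : ℕ, p.Prime → p ≠ 2 → p ∣ m → p ∣ n) → (∀ p : ℕ, p.Prime → p ≠ 2 → p ∣ n → p ∣ m) →
      2 ∣ m → ¬ 2 ∣ n → m = 2 * n := by
    intro m n hm hn b1 b2 h2m h2n
    apply Nat.dvd_antisymm
    · exact hdvd hm (mul_ne_zero two_ne_zero hn.ne_zero)
        (fun p hp hp2 hpm => (b1 p hp hp2 hpm).mul_left 2) (fun _ => Dvd.intro _ rfl)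
    · exact ((Nat.Prime.coprime_iff_not_dvd Nat.prime_two).2 h2n).mul_dvd_of_dvd_of_dvd h2m
        (hdvd hn hm.ne_zero b2 (fun h => absurd h h2n))
  by_cases h2m : 2 ∣ m
  · by_cases h2n : 2 ∣ n
    · exact h1 (Nat.dvd_antisymm (hdvd hm hn0 a1 fun _ => h2n) (hdvd hn hm0 a2 fun _ => h2m))
    · exact h2 (double hm hn a1 a2 h2m h2n)
  · by_cases h2n : 2 ∣ n
    · exact h3 (double hn hm a2 a1 h2n h2m)
    · exact h1 (Nat.dvd_antisymm (hdvd hm hn0 a1 fun h => absurd h h2m)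
        (hdvd hn hm0 a2 fun h => absurd h h2n))

lemma sum_inv_le_one_add_log (n : ℕ) : ∑ x ∈ Finset.Icc 1 n, (x : ℝ)⁻¹ ≤ 1 + log n := by
  have := harmonic_le_one_add_log n
  rw [harmonic_eq_sum_Icc] at this
  push_cast at this
  exact this

lemma card_divisors_mul_le (a b : ℕ) :
    (a * b).divisors.card ≤ a.divisors.card * b.divisors.card := by
  rw [Nat.divisors_mul]
  exact Finset.card_mul_le

lemma sum_card_divisors_pow_div_le (x k : ℕ) :
    ∑ n ∈ Finset.Icc 1 x, (n.divisors.card : ℝ) ^ k / n ≤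
      (∑ n ∈ Finset.Icc 1 x, (n : ℝ)⁻¹) ^ 2 ^ k := by
  induction k with
  | zero => simp
  | succ k ih =>
    set I := Finset.Icc 1 x with hI
    set g : ℕ → ℝ := fun n => (n.divisors.card : ℝ) ^ k / n with hg
    have hg0 : ∀ n, 0 ≤ g n := fun n => by positivity
    have hgmul : ∀ a b, g (a * b) ≤ g a * g b := by
      intro a b
      simp only [hg]
      rw [div_mul_div_comm, ← mul_pow]
      push_cast
      gcongr
      exact_mod_cast card_divisors_mul_le a b
    have h1 : ∀ n ∈ I, ∑ p ∈ (I ×ˢ I).filter (fun p => p.1 * p.2 = n), g (p.1 * p.2) =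
        (n.divisors.card : ℝ) ^ (k + 1) / n := by
      intro n hn
      have hn' := Finset.mem_Icc.1 hn
      have e : (I ×ˢ I).filter (fun p => p.1 * p.2 = n) = n.divisorsAntidiagonal := by
        ext ⟨a, b⟩
        simp only [hI, Finset.mem_filter, Finset.mem_product, Finset.mem_Icc,
          Nat.mem_divisorsAntidiagonal]
        constructor
        · rintro ⟨-, h⟩; exact ⟨h, by omega⟩
        · rintro ⟨h, h0⟩
          have ha : 0 < a := Nat.pos_of_ne_zero (by rintro rfl; simp at h; omega)
          have hb : 0 < b := Nat.pos_of_ne_zero (by rintro rfl; simp at h; omega)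
          have := Nat.le_of_dvd (by omega) (Dvd.intro _ h)
          have := Nat.le_of_dvd (by omega) (Dvd.intro_left _ h)
          exact ⟨⟨⟨ha, by omega⟩, hb, by omega⟩, h⟩
      rw [e, Finset.sum_congr rfl (g := fun _ => g n)
        (fun p hp => by rw [(Nat.mem_divisorsAntidiagonal.1 hp).1])]
      rw [Finset.sum_const, nsmul_eq_mul, ← Nat.map_div_right_divisors, Finset.card_map]
      simp only [hg]
      ring
    calc ∑ n ∈ I, (n.divisors.card : ℝ) ^ (k + 1) / n
        = ∑ n ∈ I, ∑ p ∈ (I ×ˢ I).filter (fun p => p.1 * p.2 = n), g (p.1 * p.2) :=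
          (Finset.sum_congr rfl h1).symm
      _ ≤ ∑ p ∈ I ×ˢ I, g (p.1 * p.2) :=
          Finset.sum_fiberwise_le_sum_of_sum_fiber_nonneg
            (fun _ _ => Finset.sum_nonneg fun _ _ => hg0 _)
      _ ≤ ∑ p ∈ I ×ˢ I, g p.1 * g p.2 := Finset.sum_le_sum fun p _ => hgmul _ _
      _ = (∑ n ∈ I, g n) ^ 2 := by rw [Finset.sum_product, sq, Finset.sum_mul_sum]
      _ ≤ ((∑ n ∈ I, (n : ℝ)⁻¹) ^ 2 ^ k) ^ 2 := by
          exact pow_le_pow_left₀ (Finset.sum_nonneg fun n _ => hg0 n) ih 2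
      _ = (∑ n ∈ I, (n : ℝ)⁻¹) ^ 2 ^ (k + 1) := by rw [← pow_mul, pow_succ]

lemma sum_card_divisors_pow_four_le (x : ℕ) :
    ∑ n ∈ Finset.Icc 1 x, (n.divisors.card : ℝ) ^ 4 ≤ x * (1 + log x) ^ 16 := by
  calc ∑ n ∈ Finset.Icc 1 x, (n.divisors.card : ℝ) ^ 4
      ≤ ∑ n ∈ Finset.Icc 1 x, x * ((n.divisors.card : ℝ) ^ 4 / n) := by
        refine Finset.sum_le_sum fun n hn => ?_
        have hn' := Finset.mem_Icc.1 hn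
        have h0 : (0 : ℝ) < n := by exact_mod_cast hn'.1
        have h1 : (n : ℝ) ≤ x := by exact_mod_cast hn'.2
        rw [← mul_div_assoc, le_div_iff₀ h0, mul_comm]
        gcongr
    _ = x * ∑ n ∈ Finset.Icc 1 x, (n.divisors.card : ℝ) ^ 4 / n := by rw [Finset.mul_sum]
    _ ≤ x * (∑ n ∈ Finset.Icc 1 x, (n : ℝ)⁻¹) ^ 16 := by
        gcongr; exact sum_card_divisors_pow_div_le x 4
    _ ≤ _ := by
        gcongr
        exact sum_inv_le_one_add_log x

/-- The number of ordered factorizations of `v` into three factors from `I`. -/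
lemma card_triples_le (I : Finset ℕ) {v : ℕ} (hv : v ≠ 0) :
    ((I ×ˢ I ×ˢ I).filter (fun t => t.1 * t.2.1 * t.2.2 = v)).card ≤ v.divisors.card ^ 2 := by
  rw [sq, ← Finset.card_product]
  refine Finset.card_le_card_of_injOn (fun t => (t.1, t.2.1)) ?_ ?_
  · intro t ht
    simp only [Finset.coe_filter, Set.mem_ofPred_eq] at ht
    simp only [Finset.coe_product, Set.mem_prod, Finset.mem_coe, Nat.mem_divisors]
    refine ⟨⟨⟨t.2.1 * t.2.2, by rw [← ht.2]; ring⟩, hv⟩, ⟨⟨t.1 * t.2.2, by rw [← ht.2]; ring⟩, hv⟩⟩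
  · rintro ⟨a, b, c⟩ h ⟨a', b', c'⟩ h' heq
    simp only [Finset.coe_filter, Set.mem_ofPred_eq] at h h'
    simp only [Prod.mk.injEq] at heq
    obtain ⟨rfl, rfl⟩ := heq
    have : a * b ≠ 0 := by rintro h0; rw [h0, zero_mul] at h; exact hv h.2.symm
    have := Nat.eq_of_mul_eq_mul_left (Nat.pos_of_ne_zero this) (h.2.trans h'.2.symm)
    rw [this]

/-- Cubing, followed by the Cauchy–Schwarz inequality over products of three variables. -/
lemma bilinear_pow_six_le {K : ℕ → ℕ → ℝ} (hK : ∀ n x y, K n (x * y) = K n x * K n y)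
    (S : Finset ℕ) (M : ℕ) {a : ℕ → ℝ} (ha : ∀ m, |a m| ≤ 1) :
    (∑ n ∈ S, |∑ m ∈ Finset.Icc 1 M, a m * K n m|) ^ 6 ≤
      (S.card : ℝ) ^ 4 * ((M : ℝ) ^ 3 * (1 + log ((M : ℝ) ^ 3)) ^ 16) *
        ∑ n₁ ∈ S, ∑ n₂ ∈ S, |∑ v ∈ Finset.Icc 1 (M ^ 3), K n₁ v * K n₂ v| := by
  set I := Finset.Icc 1 M with hI
  set V := Finset.Icc 1 (M ^ 3) with hV
  set T : ℕ → ℝ := fun n => ∑ m ∈ I, a m * K n m with hT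
  set A : ℕ → ℝ := fun v => ∑ t ∈ (I ×ˢ I ×ˢ I).filter (fun t => t.1 * t.2.1 * t.2.2 = v),
    a t.1 * a t.2.1 * a t.2.2 with hA
  have hcube : ∀ n, T n ^ 3 = ∑ v ∈ V, A v * K n v := by
    intro n
    have e1 : T n ^ 3 = ∑ t ∈ I ×ˢ I ×ˢ I,
        a t.1 * a t.2.1 * a t.2.2 * K n (t.1 * t.2.1 * t.2.2) := by
      rw [Finset.sum_product]
      simp_rw [Finset.sum_product]
      rw [pow_succ, sq, mul_assoc]
      simp only [hT]
      rw [Finset.sum_mul_sum, Finset.sum_mul_sum]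
      refine Finset.sum_congr rfl fun i _ => ?_
      refine (Finset.mul_sum _ _ _).symm.trans ?_
      rw [Finset.mul_sum]
      refine Finset.sum_congr rfl fun j _ => ?_
      rw [Finset.mul_sum]
      refine Finset.sum_congr rfl fun k _ => ?_
      rw [hK, hK]; ring
    rw [e1, ← Finset.sum_fiberwise_of_maps_to (t := V) (g := fun t => t.1 * t.2.1 * t.2.2)]
    · refine Finset.sum_congr rfl fun v _ => ?_
      rw [hA, Finset.sum_mul]
      refine Finset.sum_congr rfl fun t ht => ?_
      rw [(Finset.mem_filter.1 ht).2]
    · rintro ⟨x, y, z⟩ ht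
      simp only [hI, hV, Finset.mem_product, Finset.mem_Icc] at ht ⊢
      obtain ⟨⟨h1, h2⟩, ⟨h3, h4⟩, h5, h6⟩ := ht
      constructor
      · have := Nat.mul_le_mul (Nat.mul_le_mul h1 h3) h5
        simpa using this
      · calc x * y * z ≤ M * M * M := by gcongr
          _ = M ^ 3 := by ring
  have hAle : ∀ v ∈ V, A v ^ 2 ≤ (v.divisors.card : ℝ) ^ 4 := by
    intro v hv
    have hv0 : v ≠ 0 := by have := (Finset.mem_Icc.1 hv).1; omega
    have : |A v| ≤ (v.divisors.card : ℝ) ^ 2 := by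
      calc |A v| ≤ ∑ t ∈ (I ×ˢ I ×ˢ I).filter (fun t => t.1 * t.2.1 * t.2.2 = v), (1 : ℝ) := by
            refine (Finset.abs_sum_le_sum_abs _ _).trans (Finset.sum_le_sum fun t _ => ?_)
            rw [abs_mul, abs_mul]
            exact mul_le_one₀ (mul_le_one₀ (ha _) (abs_nonneg _) (ha _)) (abs_nonneg _) (ha _)
        _ ≤ (v.divisors.card : ℝ) ^ 2 := by
            rw [Finset.sum_const, nsmul_eq_mul, mul_one]
            exact_mod_cast card_triples_le I hv0
    calc A v ^ 2 = |A v| ^ 2 := (sq_abs _).symm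
      _ ≤ ((v.divisors.card : ℝ) ^ 2) ^ 2 := by gcongr
      _ = _ := by ring
  have hAsum : ∑ v ∈ V, A v ^ 2 ≤ (M : ℝ) ^ 3 * (1 + log ((M : ℝ) ^ 3)) ^ 16 := by
    refine (Finset.sum_le_sum hAle).trans ?_
    have := sum_card_divisors_pow_four_le (M ^ 3)
    push_cast at this
    exact this
  set ε : ℕ → ℝ := fun n => SignType.sign (T n ^ 3) with hε
  have hεle : ∀ n, |ε n| ≤ 1 := by
    intro n
    simp only [hε]
    rcases SignType.trichotomy (SignType.sign (T n ^ 3)) with h | h | h <;> rw [h] <;> simp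
  have habs : ∑ n ∈ S, |T n| ^ 3 = ∑ v ∈ V, A v * ∑ n ∈ S, ε n * K n v := by
    calc ∑ n ∈ S, |T n| ^ 3 = ∑ n ∈ S, ∑ v ∈ V, ε n * (A v * K n v) := by
          refine Finset.sum_congr rfl fun n _ => ?_
          rw [← abs_pow, ← Finset.mul_sum, ← hcube, ← sign_mul_self]
      _ = _ := by
          rw [Finset.sum_comm]
          refine Finset.sum_congr rfl fun v _ => ?_
          rw [Finset.mul_sum]
          exact Finset.sum_congr rfl fun n _ => by ring
  have hsecond : ∑ v ∈ V, (∑ n ∈ S, ε n * K n v) ^ 2 ≤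
      ∑ n₁ ∈ S, ∑ n₂ ∈ S, |∑ v ∈ V, K n₁ v * K n₂ v| := by
    have e : ∑ v ∈ V, (∑ n ∈ S, ε n * K n v) ^ 2 =
        ∑ n₁ ∈ S, ∑ n₂ ∈ S, ε n₁ * ε n₂ * ∑ v ∈ V, K n₁ v * K n₂ v := by
      simp_rw [sq, Finset.sum_mul_sum, Finset.mul_sum]
      rw [Finset.sum_comm]
      refine Finset.sum_congr rfl fun n₁ _ => ?_
      rw [Finset.sum_comm]
      exact Finset.sum_congr rfl fun n₂ _ => Finset.sum_congr rfl fun v _ => by ring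
    rw [e]
    refine Finset.sum_le_sum fun n₁ _ => Finset.sum_le_sum fun n₂ _ => ?_
    refine (le_abs_self _).trans ?_
    rw [abs_mul, abs_mul]
    exact mul_le_of_le_one_left (abs_nonneg _) (mul_le_one₀ (hεle _) (abs_nonneg _) (hεle _))
  have hhol : (∑ n ∈ S, |T n|) ^ 3 ≤ (S.card : ℝ) ^ 2 * ∑ n ∈ S, |T n| ^ 3 := by
    rcases S.eq_empty_or_nonempty with rfl | hS
    · simp
    · have := pow_sum_div_card_le_sum_pow (s := S) (f := fun n => |T n|) (fun n _ => abs_nonneg _) 2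
      have hc : (0 : ℝ) < (S.card : ℝ) ^ 2 := by
        have := Finset.card_pos.2 hS
        positivity
      rw [div_le_iff₀ hc, mul_comm] at this
      exact this
  have hcs := Finset.sum_mul_sq_le_sq_mul_sq V A (fun v => ∑ n ∈ S, ε n * K n v)
  have h0 : 0 ≤ ∑ n ∈ S, |T n| := Finset.sum_nonneg fun _ _ => abs_nonneg _
  have hlog : 0 ≤ (M : ℝ) ^ 3 * (1 + log ((M : ℝ) ^ 3)) ^ 16 :=
    (Finset.sum_nonneg fun _ _ => sq_nonneg _).trans hAsum
  calc (∑ n ∈ S, |T n|) ^ 6 = ((∑ n ∈ S, |T n|) ^ 3) ^ 2 := by ring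
    _ ≤ ((S.card : ℝ) ^ 2 * ∑ n ∈ S, |T n| ^ 3) ^ 2 := by gcongr
    _ = (S.card : ℝ) ^ 4 * (∑ v ∈ V, A v * ∑ n ∈ S, ε n * K n v) ^ 2 := by rw [habs]; ring
    _ ≤ (S.card : ℝ) ^ 4 * ((∑ v ∈ V, A v ^ 2) * ∑ v ∈ V, (∑ n ∈ S, ε n * K n v) ^ 2) := by
        gcongr
    _ ≤ (S.card : ℝ) ^ 4 * (((M : ℝ) ^ 3 * (1 + log ((M : ℝ) ^ 3)) ^ 16) *
        ∑ n₁ ∈ S, ∑ n₂ ∈ S, |∑ v ∈ V, K n₁ v * K n₂ v|) := by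
        gcongr
    _ = _ := by ring

/-- A bilinear form in a kernel whose rows are pairwise nearly orthogonal. -/
lemma bilinear_pow_six_le_of_orthogonal {K : ℕ → ℕ → ℝ}
    (hK : ∀ n x y, K n (x * y) = K n x * K n y) (hK1 : ∀ n x, |K n x| ≤ 1)
    {S : Finset ℕ} {N M : ℕ} (hS : S ⊆ Finset.Icc 1 N) (hNM : N ≤ M)
    (horth : ∀ n₁ ∈ S, ∀ n₂ ∈ S, n₁ ≠ n₂ → n₁ ≠ 2 * n₂ → n₂ ≠ 2 * n₁ →
      |∑ v ∈ Finset.Icc 1 (M ^ 3), K n₁ v * K n₂ v| ≤ 8 * (n₁ * n₂))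
    {a : ℕ → ℝ} (ha : ∀ m, |a m| ≤ 1) :
    (∑ n ∈ S, |∑ m ∈ Finset.Icc 1 M, a m * K n m|) ^ 6 ≤
      11 * (N : ℝ) ^ 5 * (M : ℝ) ^ 6 * (1 + 3 * log M) ^ 16 := by
  refine (bilinear_pow_six_le hK S M ha).trans ?_
  have hcard : (S.card : ℝ) ≤ N := by
    have := Finset.card_le_card hS
    rw [Nat.card_Icc] at this
    exact_mod_cast this
  have hsum : ∑ n₁ ∈ S, ∑ n₂ ∈ S, |∑ v ∈ Finset.Icc 1 (M ^ 3), K n₁ v * K n₂ v| ≤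
      11 * N * (M : ℝ) ^ 3 := by
    have hpt : ∀ n₁ ∈ S, ∀ n₂ ∈ S, |∑ v ∈ Finset.Icc 1 (M ^ 3), K n₁ v * K n₂ v| ≤
        8 * ((N : ℝ) * N) + ((if n₁ = n₂ then (M : ℝ) ^ 3 else 0) +
          (if n₁ = 2 * n₂ then (M : ℝ) ^ 3 else 0) +
          (if n₂ = 2 * n₁ then (M : ℝ) ^ 3 else 0)) := by
      intro n₁ h₁ n₂ h₂
      have hM0 : (0 : ℝ) ≤ (M : ℝ) ^ 3 := by positivity
      have hN0 : (0 : ℝ) ≤ 8 * ((N : ℝ) * N) := by positivity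
      have htriv : |∑ v ∈ Finset.Icc 1 (M ^ 3), K n₁ v * K n₂ v| ≤ (M : ℝ) ^ 3 := by
        calc |∑ v ∈ Finset.Icc 1 (M ^ 3), K n₁ v * K n₂ v|
            ≤ ∑ v ∈ Finset.Icc 1 (M ^ 3), (1 : ℝ) := by
              refine (Finset.abs_sum_le_sum_abs _ _).trans (Finset.sum_le_sum fun v _ => ?_)
              rw [abs_mul]
              exact mul_le_one₀ (hK1 _ _) (abs_nonneg _) (hK1 _ _)
          _ = (M : ℝ) ^ 3 := by simp
      by_cases c1 : n₁ = n₂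
      · rw [if_pos c1]; split_ifs <;> linarith
      by_cases c2 : n₁ = 2 * n₂
      · rw [if_pos c2]; split_ifs <;> linarith
      by_cases c3 : n₂ = 2 * n₁
      · rw [if_neg c1, if_neg c2, if_pos c3]; linarith
      rw [if_neg c1, if_neg c2, if_neg c3]
      have b1 : (n₁ : ℝ) ≤ N := by exact_mod_cast (Finset.mem_Icc.1 (hS h₁)).2
      have b2 : (n₂ : ℝ) ≤ N := by exact_mod_cast (Finset.mem_Icc.1 (hS h₂)).2
      have : 8 * ((n₁ : ℝ) * n₂) ≤ 8 * ((N : ℝ) * N) := by gcongr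
      linarith [horth n₁ h₁ n₂ h₂ c1 c2 c3]
    have hdiag : ∀ P : ℕ → ℕ → Prop, [∀ x y, Decidable (P x y)] →
        (∀ x y z, P x y → P x z → y = z) → ∀ x,
        ∑ y ∈ S, (if P x y then (M : ℝ) ^ 3 else 0) ≤ (M : ℝ) ^ 3 := by
      intro P _ hP x
      rw [← Finset.sum_filter, Finset.sum_const, nsmul_eq_mul]
      have : (S.filter (P x)).card ≤ 1 := Finset.card_le_one.2 fun y hy z hz =>
        hP x y z (Finset.mem_filter.1 hy).2 (Finset.mem_filter.1 hz).2
      have : ((S.filter (P x)).card : ℝ) ≤ 1 := by exact_mod_cast this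
      exact mul_le_of_le_one_left (by positivity) this
    have hrow : ∀ n₁ ∈ S, ∑ n₂ ∈ S, |∑ v ∈ Finset.Icc 1 (M ^ 3), K n₁ v * K n₂ v| ≤
        N * (8 * ((N : ℝ) * N)) + 3 * (M : ℝ) ^ 3 := by
      intro n₁ h₁
      refine (Finset.sum_le_sum (hpt n₁ h₁)).trans ?_
      rw [Finset.sum_add_distrib, Finset.sum_add_distrib, Finset.sum_add_distrib, Finset.sum_const,
        nsmul_eq_mul]
      have d1 := hdiag (fun x y => x = y) (by intros; omega) n₁
      have d2 := hdiag (fun x y => x = 2 * y) (by intros; omega) n₁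
      have d3 := hdiag (fun x y => y = 2 * x) (by intros; omega) n₁
      have d4 : (S.card : ℝ) * (8 * ((N : ℝ) * N)) ≤ N * (8 * ((N : ℝ) * N)) := by gcongr
      linarith
    refine (Finset.sum_le_sum hrow).trans ?_
    rw [Finset.sum_const, nsmul_eq_mul]
    have hNM' : (N : ℝ) ^ 3 ≤ (M : ℝ) ^ 3 := by gcongr
    calc (S.card : ℝ) * (N * (8 * ((N : ℝ) * N)) + 3 * (M : ℝ) ^ 3)
        ≤ N * (8 * (N : ℝ) ^ 3 + 3 * (M : ℝ) ^ 3) := by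
          have e : (N : ℝ) * (8 * ((N : ℝ) * N)) = 8 * (N : ℝ) ^ 3 := by ring
          rw [e]; gcongr
      _ ≤ N * (8 * (M : ℝ) ^ 3 + 3 * (M : ℝ) ^ 3) := by gcongr
      _ = _ := by ring
  have hlog : log ((M : ℝ) ^ 3) = 3 * log M := by rw [log_pow]; norm_num
  have hlog0 : 0 ≤ log M := log_natCast_nonneg M
  rw [hlog]
  calc _ ≤ (N : ℝ) ^ 4 * ((M : ℝ) ^ 3 * (1 + 3 * log M) ^ 16) * (11 * N * (M : ℝ) ^ 3) := by
        gcongr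
    _ = _ := by ring

lemma sum_Icc_eq_sum_odd_add_sum_double (g : ℕ → ℝ) (M : ℕ) :
    ∑ m ∈ Finset.Icc 1 M, g m =
      ∑ m ∈ Finset.Icc 1 M, (if Odd m then g m else 0) + ∑ m ∈ Finset.Icc 1 (M / 2), g (2 * m) := by
  have h : ∑ m ∈ Finset.Icc 1 (M / 2), g (2 * m) =
      ∑ m ∈ Finset.Icc 1 M, (if Odd m then 0 else g m) := by
    simp_rw [← ite_not (Odd _), ← Finset.sum_filter]
    refine Finset.sum_bij' (fun m _ => 2 * m) (fun m _ => m / 2) ?_ ?_ ?_ ?_ ?_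
    · intro m hm
      simp only [Finset.mem_Icc, Finset.mem_filter, Nat.not_odd_iff_even] at hm ⊢
      exact ⟨by omega, even_two_mul m⟩
    · intro m hm
      simp only [Finset.mem_Icc, Finset.mem_filter, Nat.not_odd_iff_even] at hm ⊢
      obtain ⟨h1, k, rfl⟩ := hm
      omega
    · intro m hm; simp
    · intro m hm
      simp only [Finset.mem_filter, Nat.not_odd_iff_even] at hm
      exact Nat.two_mul_div_two_of_even hm.2
    · intro m hm; rfl
  rw [h, ← Finset.sum_add_distrib]
  refine Finset.sum_congr rfl fun m _ => ?_
  split_ifs <;> simp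

lemma abs_sum_mul_le_sum_filter {P : ℕ → Prop} [DecidablePred P] {b : ℕ → ℝ}
    (hb : ∀ n, |b n| ≤ 1) (hb' : ∀ n, b n ≠ 0 → P n) (S : Finset ℕ) (f : ℕ → ℝ) :
    |∑ n ∈ S, b n * f n| ≤ ∑ n ∈ S.filter P, |f n| := by
  rw [Finset.sum_filter]
  refine (Finset.abs_sum_le_sum_abs _ _).trans (Finset.sum_le_sum fun n _ => ?_)
  split_ifs with h
  · rw [abs_mul]; exact mul_le_of_le_one_left (abs_nonneg _) (hb n)
  · have : b n = 0 := by by_contra h'; exact h (hb' n h')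
    simp [this]

lemma bilinear_jac_le_of_numerator_long {a b : ℕ → ℝ} {M N : ℕ}
    (ha : ∀ m, |a m| ≤ 1) (hb : ∀ n, |b n| ≤ 1)
    (ha' : ∀ m, a m ≠ 0 → Squarefree m) (hMN : M ≤ N) :
    |∑ m ∈ Finset.Icc 1 M, ∑ n ∈ Finset.Icc 1 N, a m * b n * jac n m| ^ 6 ≤
      11 * (M : ℝ) ^ 5 * (N : ℝ) ^ 6 * (1 + 3 * log N) ^ 16 := by
  have e : ∑ m ∈ Finset.Icc 1 M, ∑ n ∈ Finset.Icc 1 N, a m * b n * jac n m =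
      ∑ m ∈ Finset.Icc 1 M, a m * ∑ n ∈ Finset.Icc 1 N, b n * jac n m := by
    simp_rw [Finset.mul_sum, mul_assoc]
  rw [e]
  refine (pow_le_pow_left₀ (abs_nonneg _) (abs_sum_mul_le_sum_filter ha ha' _ _) 6).trans ?_
  refine bilinear_pow_six_le_of_orthogonal (K := fun m n => jac n m)
    (fun n x y => jac_mul_left x y n) (fun n x => abs_jac_le_one x n)
    (Finset.filter_subset _ _) hMN ?_ hb
  intro m₁ h₁ m₂ h₂ c1 c2 c3
  obtain ⟨-, s₁⟩ := Finset.mem_filter.1 h₁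
  obtain ⟨-, s₂⟩ := Finset.mem_filter.1 h₂
  have := (hasSimpleOddPrime_mul s₁ s₂ c1 c2 c3).isOscillating_numerator.abs_sum_le (N ^ 3)
  simp only [← jac_mul_right _ s₁.ne_zero s₂.ne_zero]
  refine this.trans ?_
  push_cast
  have : (0 : ℝ) ≤ m₁ * m₂ := by positivity
  linarith

lemma bilinear_jac_le_of_denominator_long_of_odd {a b : ℕ → ℝ} {M N : ℕ}
    (ha : ∀ m, |a m| ≤ 1) (hb : ∀ n, |b n| ≤ 1)
    (hb' : ∀ n, b n ≠ 0 → Squarefree n) (hodd : ∀ m, a m ≠ 0 → Odd m) (hNM : N ≤ M) :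
    |∑ m ∈ Finset.Icc 1 M, ∑ n ∈ Finset.Icc 1 N, a m * b n * jac n m| ^ 6 ≤
      11 * (N : ℝ) ^ 5 * (M : ℝ) ^ 6 * (1 + 3 * log M) ^ 16 := by
  have e : ∑ m ∈ Finset.Icc 1 M, ∑ n ∈ Finset.Icc 1 N, a m * b n * jac n m =
      ∑ n ∈ Finset.Icc 1 N, b n *
        ∑ m ∈ Finset.Icc 1 M, a m * (if Odd m then jac n m else 0) := by
    rw [Finset.sum_comm]
    refine Finset.sum_congr rfl fun n _ => ?_
    rw [Finset.mul_sum]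
    refine Finset.sum_congr rfl fun m _ => ?_
    by_cases h : a m = 0
    · simp [h]
    · rw [if_pos (hodd m h)]; ring
  rw [e]
  refine (pow_le_pow_left₀ (abs_nonneg _) (abs_sum_mul_le_sum_filter hb hb' _ _) 6).trans ?_
  refine bilinear_pow_six_le_of_orthogonal (K := fun n m => if Odd m then jac n m else 0)
    ?_ ?_ (Finset.filter_subset _ _) hNM ?_ ha
  · intro n x y
    by_cases hx : Odd x
    · by_cases hy : Odd y
      · simp only [hx, hy, hx.mul hy, if_true, jac_mul_right _ hx.pos.ne' hy.pos.ne']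
      · simp [Nat.odd_mul, hy]
    · simp [Nat.odd_mul, hx]
  · intro n x
    split_ifs
    · exact abs_jac_le_one _ _
    · simp
  · intro n₁ h₁ n₂ h₂ c1 c2 c3
    obtain ⟨-, s₁⟩ := Finset.mem_filter.1 h₁
    obtain ⟨-, s₂⟩ := Finset.mem_filter.1 h₂
    have := ((hasSimpleOddPrime_mul s₁ s₂ c1 c2 c3).isOscillating_denominator (χ := fun _ => 1)
      (by simp) (by simp) (by simp) rfl).abs_sum_le (M ^ 3)
    push_cast at this
    refine le_of_eq_of_le ?_ this
    congr 1
    refine Finset.sum_congr rfl fun v _ => ?_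
    split_ifs
    · rw [jac_mul_left, one_mul]
    · simp

lemma bilinear_jac_le_of_denominator_long {a b : ℕ → ℝ} {M N : ℕ}
    (ha : ∀ m, |a m| ≤ 1) (hb : ∀ n, |b n| ≤ 1)
    (ha' : ∀ m, a m ≠ 0 → Squarefree m) (hb' : ∀ n, b n ≠ 0 → Squarefree n) (hNM : N ≤ M) :
    |∑ m ∈ Finset.Icc 1 M, ∑ n ∈ Finset.Icc 1 N, a m * b n * jac n m| ^ 6 ≤
      64 * (11 * (N : ℝ) ^ 5 * (M : ℝ) ^ 6 * (1 + 3 * log M) ^ 16) := by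
  set B := 11 * (N : ℝ) ^ 5 * (M : ℝ) ^ 6 * (1 + 3 * log M) ^ 16 with hB
  set a₁ : ℕ → ℝ := fun m => if Odd m then a m else 0 with ha₁
  set a₂ : ℕ → ℝ := fun m => if m ≤ M / 2 then a (2 * m) else 0 with ha₂
  set b₂ : ℕ → ℝ := fun n => b n * jac n 2 with hb₂
  have e : ∑ m ∈ Finset.Icc 1 M, ∑ n ∈ Finset.Icc 1 N, a m * b n * jac n m =
      ∑ m ∈ Finset.Icc 1 M, ∑ n ∈ Finset.Icc 1 N, a₁ m * b n * jac n m +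
      ∑ m ∈ Finset.Icc 1 M, ∑ n ∈ Finset.Icc 1 N, a₂ m * b₂ n * jac n m := by
    rw [sum_Icc_eq_sum_odd_add_sum_double]
    congr 1
    · refine Finset.sum_congr rfl fun m _ => ?_
      simp only [ha₁]
      split_ifs <;> simp
    · have hsub : Finset.Icc 1 (M / 2) ⊆ Finset.Icc 1 M :=
        Finset.Icc_subset_Icc_right (Nat.div_le_self _ _)
      rw [← Finset.sum_subset hsub]
      · refine Finset.sum_congr rfl fun m hm => Finset.sum_congr rfl fun n _ => ?_
        have hm' := Finset.mem_Icc.1 hm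
        simp only [ha₂, hb₂, if_pos hm'.2]
        rw [jac_mul_right _ two_ne_zero (by omega)]
        ring
      · intro m hm hm'
        have : ¬ m ≤ M / 2 := fun h => hm' (Finset.mem_Icc.2 ⟨(Finset.mem_Icc.1 hm).1, h⟩)
        simp [ha₂, this]
  have h1 := bilinear_jac_le_of_denominator_long_of_odd (a := a₁) (b := b) (M := M) (N := N)
    (by intro m; simp only [ha₁]; split_ifs; exacts [ha m, by simp]) hb hb'
    (by intro m; simp only [ha₁]; split_ifs with h; exacts [fun _ => h, by simp]) hNM
  have h2 := bilinear_jac_le_of_denominator_long_of_odd (a := a₂) (b := b₂) (M := M) (N := N)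
    (by intro m; simp only [ha₂]; split_ifs; exacts [ha _, by simp])
    (by
      intro n; simp only [hb₂]; rw [abs_mul]
      exact mul_le_one₀ (hb n) (abs_nonneg _) (abs_jac_le_one _ _))
    (by intro n hn; exact hb' n (left_ne_zero_of_mul hn))
    (by
      intro m
      simp only [ha₂]
      split_ifs
      · intro hm
        have hs := ha' _ hm
        by_contra hodd
        obtain ⟨k, rfl⟩ := even_iff_two_dvd.1 (Nat.not_odd_iff_even.1 hodd)
        have := Nat.isUnit_iff.1 (hs 2 ⟨k, by ring⟩)
        omega
      · simp) hNM
  rw [e]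
  rw [← hB] at h1 h2
  set s := ∑ m ∈ Finset.Icc 1 M, ∑ n ∈ Finset.Icc 1 N, a₁ m * b n * jac n m
  set t := ∑ m ∈ Finset.Icc 1 M, ∑ n ∈ Finset.Icc 1 N, a₂ m * b₂ n * jac n m
  rcases le_total |s| |t| with h | h
  · calc |s + t| ^ 6 ≤ (2 * |t|) ^ 6 := by
          gcongr; exact (abs_add_le _ _).trans (by linarith)
      _ = 64 * |t| ^ 6 := by ring
      _ ≤ _ := by gcongr
  · calc |s + t| ^ 6 ≤ (2 * |s|) ^ 6 := by
          gcongr; exact (abs_add_le _ _).trans (by linarith)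
      _ = 64 * |s| ^ 6 := by ring
      _ ≤ _ := by gcongr

lemma bilinear_jac_box_le {a b : ℕ → ℝ} {M N : ℕ}
    (ha : ∀ m, |a m| ≤ 1) (hb : ∀ n, |b n| ≤ 1)
    (ha' : ∀ m, a m ≠ 0 → Squarefree m) (hb' : ∀ n, b n ≠ 0 → Squarefree n)
    {L ℓ : ℝ} (hL : 0 < L) (hLM : L ≤ M) (hLN : L ≤ N) (hM : log M ≤ ℓ)
    (hN : log N ≤ ℓ) :
    |∑ m ∈ Finset.Icc 1 M, ∑ n ∈ Finset.Icc 1 N, a m * b n * jac n m| ^ 6 ≤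
      704 * ((M : ℝ) * N) ^ 6 / L * (1 + 3 * ℓ) ^ 16 := by
  have h5 : ∀ x : ℝ, L ≤ x → x ^ 5 ≤ x ^ 6 / L := by
    intro x hx
    rw [le_div_iff₀ hL, pow_succ x 5]
    have := hL.le.trans hx
    gcongr
  have hlogM := log_natCast_nonneg M
  have hlogN := log_natCast_nonneg N
  rcases le_total M N with h | h
  · calc _ ≤ 11 * (M : ℝ) ^ 5 * (N : ℝ) ^ 6 * (1 + 3 * log N) ^ 16 :=
          bilinear_jac_le_of_numerator_long ha hb ha' h
      _ ≤ 704 * ((M : ℝ) ^ 6 / L) * (N : ℝ) ^ 6 * (1 + 3 * ℓ) ^ 16 := by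
          gcongr
          · norm_num
          · exact h5 _ hLM
      _ = _ := by ring
  · calc _ ≤ 64 * (11 * (N : ℝ) ^ 5 * (M : ℝ) ^ 6 * (1 + 3 * log M) ^ 16) :=
          bilinear_jac_le_of_denominator_long ha hb ha' hb' h
      _ = 704 * (N : ℝ) ^ 5 * (M : ℝ) ^ 6 * (1 + 3 * log M) ^ 16 := by ring
      _ ≤ 704 * ((N : ℝ) ^ 6 / L) * (M : ℝ) ^ 6 * (1 + 3 * ℓ) ^ 16 := by
          gcongr
          exact h5 _ hLN
      _ = _ := by ring

lemma card_filter_lt_le (T : ℕ) {u v : ℝ} (hu : 0 ≤ u) (huv : u ≤ v) :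
    (((Finset.Icc 1 T).filter (fun n : ℕ => u < n ∧ (n : ℝ) ≤ v)).card : ℝ) ≤ v - u + 1 := by
  have hsub : (Finset.Icc 1 T).filter (fun n : ℕ => u < n ∧ (n : ℝ) ≤ v) ⊆
      Finset.Ioc ⌊u⌋₊ ⌊v⌋₊ := by
    intro n hn
    obtain ⟨-, h1, h2⟩ := Finset.mem_filter.1 hn
    exact Finset.mem_Ioc.2 ⟨(Nat.floor_lt hu).2 h1, Nat.le_floor h2⟩
  have h := Finset.card_le_card hsub
  rw [Nat.card_Ioc] at h
  have hfl : ⌊u⌋₊ ≤ ⌊v⌋₊ := Nat.floor_le_floor huv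
  have h' : (((Finset.Icc 1 T).filter (fun n : ℕ => u < n ∧ (n : ℝ) ≤ v)).card : ℝ) ≤
      (⌊v⌋₊ : ℝ) - ⌊u⌋₊ := by
    rw [← Nat.cast_sub hfl]; exact_mod_cast h
  have h1 := Nat.floor_le (hu.trans huv)
  have h2 := Nat.lt_floor_add_one u
  linarith

lemma bilinear_jac_piece_le {a b : ℕ → ℝ} (ha : ∀ m, |a m| ≤ 1) (hb : ∀ n, |b n| ≤ 1)
    {ℓ Y : ℝ} (hℓ : 1 ≤ ℓ) (hY : 0 < Y) (hYℓ : log Y ≤ ℓ)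
    (ha' : ∀ m, a m ≠ 0 → Squarefree m ∧ ℓ ^ 96 < m)
    (hb' : ∀ n, b n ≠ 0 → Squarefree n ∧ ℓ ^ 96 < n)
    {T : ℕ} {A : Finset ℕ} {t : ℝ} (ht : 0 ≤ t) (hA : ∀ m ∈ A, 1 ≤ m ∧ (m : ℝ) ≤ exp t) :
    |∑ m ∈ A, ∑ n ∈ (Finset.Icc 1 T).filter (fun n : ℕ => (n : ℝ) * exp t ≤ Y),
        a m * b n * jac n m| ≤ if t ≤ ℓ then 128 * Y / ℓ ^ 13 else 0 := by
  have hD : 0 ≤ 128 * Y / ℓ ^ 13 := by positivity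
  by_cases h0 : ∑ m ∈ A, ∑ n ∈ (Finset.Icc 1 T).filter (fun n : ℕ => (n : ℝ) * exp t ≤ Y),
        a m * b n * jac n m = 0
  · rw [h0, abs_zero]
    split_ifs
    exacts [hD, le_rfl]
  obtain ⟨m, hm, hm0⟩ := Finset.exists_ne_zero_of_sum_ne_zero h0
  obtain ⟨n, hn, hn0⟩ := Finset.exists_ne_zero_of_sum_ne_zero hm0
  have ham := ha' m (left_ne_zero_of_mul (left_ne_zero_of_mul hn0))
  have hbn := hb' n (right_ne_zero_of_mul (left_ne_zero_of_mul hn0))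
  obtain ⟨hn1, hnY⟩ := Finset.mem_filter.1 hn
  have hE := exp_pos t
  have hn1' : (1 : ℝ) ≤ n := by exact_mod_cast (Finset.mem_Icc.1 hn1).1
  have hEY : exp t ≤ Y := le_trans (le_mul_of_one_le_left hE.le hn1') hnY
  have htℓ : t ≤ ℓ := ((le_log_iff_exp_le hY).2 hEY).trans hYℓ
  rw [if_pos htℓ]
  set M := ⌊exp t⌋₊ with hM
  set N := ⌊Y / exp t⌋₊ with hN
  have hmM : m ≤ M := Nat.le_floor (hA m hm).2
  have hnN : n ≤ N := Nat.le_floor (by rw [le_div_iff₀ hE]; exact hnY)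
  have hM0 : (0 : ℝ) < M := by exact_mod_cast lt_of_lt_of_le (hA m hm).1 hmM
  have hN0 : (0 : ℝ) < N := by exact_mod_cast lt_of_lt_of_le (Finset.mem_Icc.1 hn1).1 hnN
  have hMle : (M : ℝ) ≤ exp t := Nat.floor_le hE.le
  have hNle : (N : ℝ) ≤ Y / exp t := Nat.floor_le (by positivity)
  set a₁ : ℕ → ℝ := fun m => if m ∈ A then a m else 0 with ha₁
  set b₁ : ℕ → ℝ := fun n => if n ∈ Finset.Icc 1 T then b n else 0 with hb₁
  have e : ∑ m ∈ A, ∑ n ∈ (Finset.Icc 1 T).filter (fun n : ℕ => (n : ℝ) * exp t ≤ Y),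
        a m * b n * jac n m =
      ∑ m ∈ Finset.Icc 1 M, ∑ n ∈ Finset.Icc 1 N, a₁ m * b₁ n * jac n m := by
    have e1 : A = (Finset.Icc 1 M).filter (· ∈ A) := by
      ext k
      simp only [Finset.mem_filter, Finset.mem_Icc]
      exact ⟨fun hk => ⟨⟨(hA k hk).1, Nat.le_floor (hA k hk).2⟩, hk⟩, fun hk => hk.2⟩
    have e2 : (Finset.Icc 1 T).filter (fun n : ℕ => (n : ℝ) * exp t ≤ Y) =
        (Finset.Icc 1 N).filter (· ∈ Finset.Icc 1 T) := by
      ext k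
      simp only [Finset.mem_filter, Finset.mem_Icc, hN, Nat.le_floor_iff (by positivity :
        (0 : ℝ) ≤ Y / exp t), le_div_iff₀ hE]
      tauto
    rw [e2]
    conv_lhs => rw [e1]
    rw [Finset.sum_filter]
    refine Finset.sum_congr rfl fun k _ => ?_
    simp only [ha₁]
    split_ifs
    · rw [Finset.sum_filter]
      refine Finset.sum_congr rfl fun i _ => ?_
      simp only [hb₁]
      split_ifs <;> simp
    · simp
  rw [e]
  have hbox := bilinear_jac_box_le (a := a₁) (b := b₁) (M := M) (N := N) (L := ℓ ^ 96) (ℓ := ℓ)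
    (by intro m; simp only [ha₁]; split_ifs; exacts [ha m, by simp])
    (by intro m; simp only [hb₁]; split_ifs; exacts [hb m, by simp])
    (by intro m; simp only [ha₁]; split_ifs; exacts [fun h => (ha' m h).1, by simp])
    (by intro m; simp only [hb₁]; split_ifs; exacts [fun h => (hb' m h).1, by simp])
    (by positivity)
    (ham.2.le.trans (by exact_mod_cast hmM)) (hbn.2.le.trans (by exact_mod_cast hnN))
    ((log_le_log hM0 (hMle.trans hEY)).trans hYℓ)
    ((log_le_log hN0 (hNle.trans (div_le_self hY.le (one_le_exp ht)))).trans hYℓ)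
  have hMN : (M : ℝ) * N ≤ Y := by
    calc (M : ℝ) * N ≤ exp t * (Y / exp t) := by gcongr
      _ = Y := by field_simp
  refine le_of_pow_le_pow_left₀ (n := 6) (by norm_num) hD (hbox.trans ?_)
  calc 704 * ((M : ℝ) * N) ^ 6 / ℓ ^ 96 * (1 + 3 * ℓ) ^ 16
      ≤ 704 * Y ^ 6 / ℓ ^ 96 * (4 * ℓ) ^ 16 := by
        gcongr
        linarith
    _ = 704 * 4 ^ 16 * Y ^ 6 * 1 / ℓ ^ 80 := by field_simp
    _ ≤ 704 * 4 ^ 16 * Y ^ 6 * ℓ ^ 2 / ℓ ^ 80 := by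
        gcongr
        exact one_le_pow₀ hℓ
    _ = 704 * 4 ^ 16 * (Y ^ 6 / ℓ ^ 78) := by field_simp
    _ ≤ 128 ^ 6 * (Y ^ 6 / ℓ ^ 78) := by
        gcongr
        norm_num
    _ = _ := by field_simp

lemma bilinear_boundary_le {ℓ Y : ℝ} (hℓ : 1 ≤ ℓ) (hY : 0 < Y) (hYℓ : log Y ≤ ℓ) {T : ℕ}
    {E : ℕ → ℝ} (hE : ∀ m : ℕ, 1 ≤ m → (m : ℝ) ≤ E m ∧ E m ≤ m * exp (1 / ℓ ^ 6)) :
    ∑ m ∈ (Finset.Icc 1 T).filter (fun m : ℕ => (m : ℝ) * ℓ ^ 96 ≤ Y),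
      (((Finset.Icc 1 T).filter (fun n : ℕ => Y / E m < n ∧ (n : ℝ) ≤ Y / m)).card : ℝ) ≤
      3 * Y / ℓ ^ 5 := by
  have hℓ0 : 0 < ℓ := by linarith
  set Z := ⌊Y / ℓ ^ 96⌋₊ with hZ
  have hZle : (Z : ℝ) ≤ Y / ℓ ^ 96 := Nat.floor_le (by positivity)
  have hsub : (Finset.Icc 1 T).filter (fun m : ℕ => (m : ℝ) * ℓ ^ 96 ≤ Y) ⊆ Finset.Icc 1 Z := by
    intro m hm
    obtain ⟨h1, h2⟩ := Finset.mem_filter.1 hm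
    exact Finset.mem_Icc.2 ⟨(Finset.mem_Icc.1 h1).1, Nat.le_floor
      (by rwa [le_div_iff₀ (by positivity)])⟩
  refine (Finset.sum_le_sum_of_subset_of_nonneg hsub fun _ _ _ => by positivity).trans ?_
  have hpt : ∀ m ∈ Finset.Icc 1 Z,
      (((Finset.Icc 1 T).filter (fun n : ℕ => Y / E m < n ∧ (n : ℝ) ≤ Y / m)).card : ℝ) ≤
        Y / ℓ ^ 6 * (m : ℝ)⁻¹ + 1 := by
    intro m hm
    have hm1 := (Finset.mem_Icc.1 hm).1
    have hm0 : (0 : ℝ) < m := by exact_mod_cast hm1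
    obtain ⟨h1, h2⟩ := hE m hm1
    have hE0 : 0 < E m := hm0.trans_le h1
    refine (card_filter_lt_le T (by positivity) (by gcongr)).trans ?_
    have h3 : Y / m * (1 - 1 / ℓ ^ 6) ≤ Y / E m := by
      calc Y / m * (1 - 1 / ℓ ^ 6) ≤ Y / m * exp (-(1 / ℓ ^ 6)) := by
            gcongr
            have := add_one_le_exp (-(1 / ℓ ^ 6))
            linarith
        _ = Y / (m * exp (1 / ℓ ^ 6)) := by rw [exp_neg]; field_simp
        _ ≤ Y / E m := by gcongr
    have h4 : Y / m * (1 - 1 / ℓ ^ 6) = Y / m - Y / ℓ ^ 6 * (m : ℝ)⁻¹ := by field_simp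
    linarith
  refine (Finset.sum_le_sum hpt).trans ?_
  rw [Finset.sum_add_distrib, ← Finset.mul_sum, Finset.sum_const, nsmul_eq_mul, mul_one,
    Nat.card_Icc, Nat.add_sub_cancel]
  have hlogZ : log Z ≤ ℓ := by
    rcases Nat.eq_zero_or_pos Z with h | h
    · rw [h]; simp; linarith
    · refine (log_le_log (by exact_mod_cast h) (hZle.trans ?_)).trans hYℓ
      exact div_le_self hY.le (one_le_pow₀ hℓ)
  calc Y / ℓ ^ 6 * ∑ m ∈ Finset.Icc 1 Z, (m : ℝ)⁻¹ + Z
      ≤ Y / ℓ ^ 6 * (ℓ + ℓ) + Y / ℓ ^ 5 := by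
        gcongr
        · exact (sum_inv_le_one_add_log Z).trans (by linarith)
        · refine hZle.trans ?_
          gcongr
          norm_num
    _ = 3 * Y / ℓ ^ 5 := by field_simp; ring

lemma bilinear_jac_hyperbola_le {a b : ℕ → ℝ} (ha : ∀ m, |a m| ≤ 1) (hb : ∀ n, |b n| ≤ 1)
    {ℓ Y : ℝ} (hℓ : 1 ≤ ℓ) (hY : 0 < Y) (hYℓ : log Y ≤ ℓ)
    (ha' : ∀ m, a m ≠ 0 → Squarefree m ∧ ℓ ^ 96 < m)
    (hb' : ∀ n, b n ≠ 0 → Squarefree n ∧ ℓ ^ 96 < n) (T : ℕ) :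
    |∑ m ∈ Finset.Icc 1 T, ∑ n ∈ Finset.Icc 1 T,
        if (m : ℝ) * n ≤ Y then a m * b n * jac n m else 0| ≤ 131 * Y / ℓ ^ 5 := by
  have hR : 0 < ℓ ^ 6 := by positivity
  set j : ℕ → ℕ := fun m => ⌊ℓ ^ 6 * log m⌋₊ with hj
  set τ : ℕ → ℝ := fun i => ((i : ℝ) + 1) / ℓ ^ 6 with hτ
  set I := Finset.Icc 1 T with hI
  have hE : ∀ m : ℕ, 1 ≤ m → (m : ℝ) ≤ exp (τ (j m)) ∧
      exp (τ (j m)) ≤ m * exp (1 / ℓ ^ 6) := by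
    intro m hm
    have hm0 : (0 : ℝ) < m := by exact_mod_cast hm
    constructor
    · rw [← log_le_iff_le_exp hm0]
      simp only [hτ]
      rw [le_div_iff₀ hR, mul_comm]
      exact (Nat.lt_floor_add_one _).le
    · have : (j m : ℝ) ≤ ℓ ^ 6 * log m :=
        Nat.floor_le (mul_nonneg hR.le (log_natCast_nonneg m))
      have h2 : (j m : ℝ) / ℓ ^ 6 ≤ log m := by rw [div_le_iff₀ hR, mul_comm]; exact this
      simp only [hτ]
      rw [add_div, exp_add]
      gcongr
      exact (le_log_iff_exp_le hm0).1 h2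
  have hsplit : ∀ m ∈ I, ∑ n ∈ I, (if (m : ℝ) * n ≤ Y then a m * b n * jac n m else 0) =
      ∑ n ∈ I.filter (fun n : ℕ => (n : ℝ) * exp (τ (j m)) ≤ Y), a m * b n * jac n m +
      ∑ n ∈ I.filter (fun n : ℕ => Y / exp (τ (j m)) < n ∧ (n : ℝ) ≤ Y / m),
        a m * b n * jac n m := by
    intro m hm
    have hm1 := (Finset.mem_Icc.1 hm).1
    have hm0 : (0 : ℝ) < m := by exact_mod_cast hm1
    rw [Finset.sum_filter, Finset.sum_filter, ← Finset.sum_add_distrib]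
    refine Finset.sum_congr rfl fun n _ => ?_
    have c1 : Y / exp (τ (j m)) < n ↔ ¬ (n : ℝ) * exp (τ (j m)) ≤ Y := by
      rw [div_lt_iff₀ (exp_pos _), not_le]
    have c2 : (n : ℝ) ≤ Y / m ↔ (m : ℝ) * n ≤ Y := by rw [le_div_iff₀ hm0, mul_comm]
    simp only [c1, c2]
    by_cases h1 : (n : ℝ) * exp (τ (j m)) ≤ Y
    · have : (m : ℝ) * n ≤ Y := by
        refine le_trans ?_ h1
        rw [mul_comm]
        exact mul_le_mul_of_nonneg_left (hE m hm1).1 (Nat.cast_nonneg n)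
      simp [h1, this]
    · simp [h1]
  rw [Finset.sum_congr rfl hsplit, Finset.sum_add_distrib]
  have hmain : |∑ m ∈ I, ∑ n ∈ I.filter (fun n : ℕ => (n : ℝ) * exp (τ (j m)) ≤ Y),
      a m * b n * jac n m| ≤ 128 * Y / ℓ ^ 5 * 1 := by
    rw [← Finset.sum_fiberwise_of_maps_to (t := I.image j) (g := j)
      (fun m hm => Finset.mem_image_of_mem j hm)]
    refine (Finset.abs_sum_le_sum_abs _ _).trans ?_
    have hpiece : ∀ i ∈ I.image j, |∑ m ∈ I.filter (fun m => j m = i),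
        ∑ n ∈ I.filter (fun n : ℕ => (n : ℝ) * exp (τ (j m)) ≤ Y), a m * b n * jac n m| ≤
        if τ i ≤ ℓ then 128 * Y / ℓ ^ 13 else 0 := by
      intro i _
      have := bilinear_jac_piece_le ha hb hℓ hY hYℓ ha' hb' (T := T)
        (A := I.filter (fun m => j m = i)) (t := τ i) (by positivity) (by
          intro m hm
          obtain ⟨h1, h2⟩ := Finset.mem_filter.1 hm
          have h3 := (Finset.mem_Icc.1 h1).1
          exact ⟨h3, h2 ▸ (hE m h3).1⟩)
      refine le_of_eq_of_le ?_ this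
      congr 1
      refine Finset.sum_congr rfl fun m hm => ?_
      rw [(Finset.mem_filter.1 hm).2]
    refine (Finset.sum_le_sum hpiece).trans ?_
    rw [← Finset.sum_filter, Finset.sum_const, nsmul_eq_mul]
    have hcard : (((I.image j).filter (fun i => τ i ≤ ℓ)).card : ℝ) ≤ ℓ ^ 7 := by
      have hsub : (I.image j).filter (fun i => τ i ≤ ℓ) ⊆ Finset.range ⌊ℓ ^ 7⌋₊ := by
        intro i hi
        have h1 := (Finset.mem_filter.1 hi).2
        simp only [hτ] at h1
        rw [div_le_iff₀ hR] at h1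
        rw [Finset.mem_range]
        refine Nat.lt_of_succ_le (Nat.le_floor ?_)
        push_cast
        calc (i : ℝ) + 1 ≤ ℓ * ℓ ^ 6 := h1
          _ = ℓ ^ 7 := by ring
      have := Finset.card_le_card hsub
      rw [Finset.card_range] at this
      exact (Nat.cast_le.2 this).trans (Nat.floor_le (by positivity))
    calc _ ≤ ℓ ^ 7 * (128 * Y / ℓ ^ 13) := by gcongr
      _ = 128 * Y / ℓ ^ 6 := by field_simp
      _ ≤ 128 * Y / ℓ ^ 5 * 1 := by
          rw [mul_one]
          gcongr
          norm_num
  have herr : |∑ m ∈ I, ∑ n ∈ I.filter (fun n : ℕ => Y / exp (τ (j m)) < n ∧ (n : ℝ) ≤ Y / m),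
      a m * b n * jac n m| ≤ 3 * Y / ℓ ^ 5 := by
    refine le_trans ?_ (bilinear_boundary_le hℓ hY hYℓ (T := T) (E := fun m => exp (τ (j m))) hE)
    refine (Finset.abs_sum_le_sum_abs _ _).trans ?_
    rw [Finset.sum_filter]
    refine Finset.sum_le_sum fun m hm => ?_
    have hm0 : (0 : ℝ) < m := by exact_mod_cast (Finset.mem_Icc.1 hm).1
    split_ifs with h
    · rw [Finset.card_eq_sum_ones]
      push_cast
      refine (Finset.abs_sum_le_sum_abs _ _).trans (Finset.sum_le_sum fun n _ => ?_)
      rw [abs_mul, abs_mul]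
      exact mul_le_one₀ (mul_le_one₀ (ha _) (abs_nonneg _) (hb _)) (abs_nonneg _)
        (abs_jac_le_one _ _)
    · rw [Finset.sum_eq_zero, abs_zero]
      intro n hn
      have hn2 := (Finset.mem_filter.1 hn).2.2
      have : b n = 0 := by
        by_contra hbn
        refine h (le_trans ?_ ((le_div_iff₀ hm0).1 hn2))
        rw [mul_comm]
        exact mul_le_mul_of_nonneg_right (hb' n hbn).2.le hm0.le
      simp [this]
  calc _ ≤ 128 * Y / ℓ ^ 5 * 1 + 3 * Y / ℓ ^ 5 := (abs_add_le _ _).trans (add_le_add hmain herr)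
    _ = _ := by ring

lemma sum_divisors_moebius (n : ℕ) :
    ∑ d ∈ n.divisors, (ArithmeticFunction.moebius d : ℝ) = if n = 1 then 1 else 0 := by
  have h := congrArg (fun f : ArithmeticFunction ℝ => f n)
    (ArithmeticFunction.coe_moebius_mul_coe_zeta (R := ℝ))
  simp only [ArithmeticFunction.coe_mul_zeta_apply, ArithmeticFunction.one_apply] at h
  simpa using h

lemma sum_Icc_filter_dvd (f : ℕ → ℝ) (Z : ℕ) {d : ℕ} (hd : 0 < d) :
    ∑ x ∈ Finset.Icc 1 Z, (if d ∣ x then f x else 0) = ∑ y ∈ Finset.Icc 1 (Z / d), f (d * y) := by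
  rw [← Finset.sum_filter]
  refine Finset.sum_bij' (fun x _ => x / d) (fun y _ => d * y) ?_ ?_ ?_ ?_ ?_
  · intro x hx
    simp only [Finset.mem_Icc, Finset.mem_filter] at hx ⊢
    exact ⟨Nat.div_pos (Nat.le_of_dvd hx.1.1 hx.2) hd, Nat.div_le_div_right hx.1.2⟩
  · intro y hy
    simp only [Finset.mem_Icc, Finset.mem_filter] at hy ⊢
    exact ⟨⟨Nat.mul_pos hd hy.1, by rw [mul_comm]; exact (Nat.le_div_iff_mul_le hd).1 hy.2⟩,
      Dvd.intro _ rfl⟩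
  · intro x hx
    exact Nat.mul_div_cancel' (Finset.mem_filter.1 hx).2
  · intro y _
    exact Nat.mul_div_cancel_left _ hd
  · intro x hx
    rw [Nat.mul_div_cancel' (Finset.mem_filter.1 hx).2]

lemma abs_moebius_cast_le_one (d : ℕ) : |(ArithmeticFunction.moebius d : ℝ)| ≤ 1 := by
  exact_mod_cast ArithmeticFunction.abs_moebius_le_one (n := d)

lemma IsOscillating.nonneg {g : ℕ → ℝ} {B : ℝ} (h : IsOscillating g B) : 0 ≤ B :=
  (abs_nonneg _).trans (h.abs_sum_le 0)

lemma IsOscillating.abs_sum_moebius_dvd_le {g : ℕ → ℝ} {B : ℝ} (h : IsOscillating g B)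
    (D : Finset ℕ) {e : ℕ → ℕ} (he : ∀ d ∈ D, 0 < e d) (Z : ℕ) :
    |∑ x ∈ Finset.Icc 1 Z, g x *
      ∑ d ∈ D, (if e d ∣ x then (ArithmeticFunction.moebius d : ℝ) else 0)| ≤ D.card * B := by
  simp_rw [Finset.mul_sum]
  rw [Finset.sum_comm]
  refine (Finset.abs_sum_le_sum_abs _ _).trans ?_
  rw [← nsmul_eq_mul]
  refine Finset.sum_le_card_nsmul _ _ _ fun d hd => ?_
  have : ∑ x ∈ Finset.Icc 1 Z,
      g x * (if e d ∣ x then (ArithmeticFunction.moebius d : ℝ) else 0) =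
      (ArithmeticFunction.moebius d : ℝ) * g (e d) *
        ∑ y ∈ Finset.Icc 1 (Z / e d), g y := by
    rw [Finset.mul_sum]
    simp_rw [mul_assoc, ← h.map_mul]
    rw [← sum_Icc_filter_dvd (fun x => (ArithmeticFunction.moebius d : ℝ) * g x) Z (he d hd)]
    refine Finset.sum_congr rfl fun x _ => ?_
    split_ifs <;> ring
  rw [this, abs_mul, abs_mul]
  calc _ ≤ 1 * 1 * B := by
        gcongr
        · exact abs_moebius_cast_le_one d
        · exact h.abs_le_one _
        · exact h.abs_sum_le _
    _ = B := by ring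

lemma IsOscillating.coprime {g : ℕ → ℝ} {B : ℝ} (h : IsOscillating g B) {w : ℕ} (hw : w ≠ 0) :
    IsOscillating (fun x => if x.Coprime w then g x else 0) (w.divisors.card * B) := by
  refine ⟨fun x y => ?_, fun x => ?_, fun Z => ?_⟩
  · simp only [Nat.coprime_mul_iff_left, h.map_mul]
    split_ifs <;> simp_all
  · split_ifs
    · exact h.abs_le_one x
    · simp
  · refine le_of_eq_of_le ?_ (h.abs_sum_moebius_dvd_le w.divisors (e := id)
      (fun d hd => Nat.pos_of_mem_divisors hd) Z)
    congr 1
    refine Finset.sum_congr rfl fun x hx => ?_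
    have h1 : (x.gcd w).divisors = w.divisors.filter (fun d => d ∣ x) := by
      ext d
      simp only [Nat.mem_divisors, Finset.mem_filter, Nat.dvd_gcd_iff, ne_eq, Nat.gcd_eq_zero_iff]
      tauto
    have h2 := sum_divisors_moebius (x.gcd w)
    rw [h1, Finset.sum_filter] at h2
    simp only [id]
    rw [h2]
    simp [Nat.Coprime]

lemma sum_moebius_sq_dvd {x Z : ℕ} (hx : 0 < x) (hxZ : x ≤ Z) :
    ∑ d ∈ Finset.Icc 1 Z.sqrt, (if d ^ 2 ∣ x then (ArithmeticFunction.moebius d : ℝ) else 0) =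
      if Squarefree x then 1 else 0 := by
  obtain ⟨a, b, rfl, ha⟩ := Nat.sq_mul_squarefree x
  have hb0 : b ≠ 0 := by rintro rfl; simp at hx
  have ha0 := ha.ne_zero
  have hdvd : ∀ d, d ^ 2 ∣ b ^ 2 * a ↔ d ∣ b := by
    intro d
    refine ⟨fun h => ?_, fun h => (pow_dvd_pow_of_dvd h 2).mul_right a⟩
    have hd0 : d ≠ 0 := by
      rintro rfl
      simp [hb0, ha0] at h
    rw [← Nat.factorization_le_iff_dvd hd0 hb0]
    intro p
    have h3 := (Nat.factorization_le_iff_dvd (pow_ne_zero 2 hd0) hx.ne').2 h p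
    rw [Nat.factorization_mul (pow_ne_zero 2 hb0) ha0, Nat.factorization_pow,
      Nat.factorization_pow] at h3
    have h4 := ha.natFactorization_le_one p
    simp at h3
    omega
  have hset : (Finset.Icc 1 Z.sqrt).filter (fun d => d ^ 2 ∣ b ^ 2 * a) = b.divisors := by
    ext d
    simp only [Finset.mem_filter, Finset.mem_Icc, hdvd, Nat.mem_divisors]
    refine ⟨fun h => ⟨h.2, hb0⟩, fun h => ⟨⟨Nat.pos_of_dvd_of_pos h.1 (Nat.pos_of_ne_zero hb0), ?_⟩,
      h.1⟩⟩
    rw [Nat.le_sqrt']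
    exact (Nat.le_of_dvd hx ((hdvd d).2 h.1)).trans hxZ
  rw [← Finset.sum_filter, hset, sum_divisors_moebius b]
  have : Squarefree (b ^ 2 * a) ↔ b = 1 := by
    constructor
    · intro h
      exact Nat.isUnit_iff.1 (h b ⟨a, by ring⟩)
    · rintro rfl
      simpa using ha
  simp only [this]

lemma IsOscillating.abs_sum_squarefree_le {g : ℕ → ℝ} {B : ℝ} (h : IsOscillating g B) (Z : ℕ) :
    |∑ x ∈ Finset.Icc 1 Z, (if Squarefree x then g x else 0)| ≤ B * √Z := by
  have h1 := h.abs_sum_moebius_dvd_le (Finset.Icc 1 Z.sqrt) (e := fun d => d ^ 2)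
    (fun d hd => pow_pos (Finset.mem_Icc.1 hd).1 2) Z
  rw [Finset.sum_congr rfl (fun x hx => by
    rw [sum_moebius_sq_dvd (Finset.mem_Icc.1 hx).1 (Finset.mem_Icc.1 hx).2])] at h1
  simp only [mul_ite, mul_one, mul_zero, Nat.card_Icc, Nat.add_sub_cancel] at h1
  refine h1.trans ?_
  rw [mul_comm]
  exact mul_le_mul_of_nonneg_left Real.nat_sqrt_le_real_sqrt h.nonneg

lemma IsOscillating.abs_sum_squarefree_mul_le {g : ℕ → ℝ} {B : ℝ} (h : IsOscillating g B)
    {w : ℕ} (hw : w ≠ 0) (Z : ℕ) :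
    |∑ x ∈ Finset.Icc 1 Z, (if Squarefree (x * w) then g x else 0)| ≤
      w.divisors.card * B * √Z := by
  by_cases hs : Squarefree w
  · refine le_of_eq_of_le ?_ ((h.coprime hw).abs_sum_squarefree_le Z)
    congr 1
    refine Finset.sum_congr rfl fun x _ => ?_
    simp only [Nat.squarefree_mul_iff, hs, and_true]
    split_ifs <;> simp_all
  · rw [Finset.sum_eq_zero, abs_zero]
    · have := h.nonneg
      positivity
    · intro x _
      rw [if_neg]
      exact fun h' => hs (Nat.squarefree_mul_iff.1 h').2.2

lemma exists_reciprocity_character_of_odd {s : ℕ} (hs : Odd s) :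
    ∃ χ : ℕ → ℝ, (∀ x y, χ (x * y) = χ x * χ y) ∧ (∀ x, |χ x| ≤ 1) ∧
      (∀ x y, x ≡ y [MOD 8] → χ x = χ y) ∧ χ 1 = 1 ∧
      ∀ x, Odd x → x.Coprime s → jac s x * jac x s = χ x := by
  have h4 : s % 4 = 1 ∨ s % 4 = 3 := by
    have := Nat.odd_iff.1 hs
    omega
  rcases h4 with h4 | h4
  · refine ⟨fun _ => 1, by simp, by simp, by simp, rfl, fun x hx hxs => ?_⟩
    have : jac s x = jac x s := by
      unfold jac
      rw [jacobiSym.quadratic_reciprocity_one_mod_four h4 hx]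
    rw [this, jac_mul_self hxs]
  · refine ⟨fun x => ((ZMod.χ₄ (x : ZMod 4) : ℤ) : ℝ), ?_, ?_, ?_, by simp, fun x hx hxs => ?_⟩
    · intro x y
      simp only [Nat.cast_mul, _root_.map_mul, Int.cast_mul]
    · intro x
      have : ∀ u : ZMod 4, |ZMod.χ₄ u| ≤ 1 := by decide
      rw [← Int.cast_abs]
      exact_mod_cast this x
    · intro x y hxy
      have : (x : ZMod 4) = y := (ZMod.natCast_eq_natCast_iff _ _ _).2 (hxy.of_dvd ⟨2, rfl⟩)
      simp only [this]
    · have h1 : x % 4 = 1 ∨ x % 4 = 3 := by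
        have := Nat.odd_iff.1 hx
        omega
      rcases h1 with h1 | h1
      · have e : jac x s = jac s x := by
          unfold jac
          rw [jacobiSym.quadratic_reciprocity_one_mod_four h1 hs]
        have e2 : ZMod.χ₄ (x : ZMod 4) = 1 := ZMod.χ₄_nat_one_mod_four h1
        rw [← e, jac_mul_self hxs]
        simp only [e2, Int.cast_one]
      · have e : jac s x = - jac x s := by
          unfold jac
          rw [jacobiSym.quadratic_reciprocity_three_mod_four h4 h1]
          simp
        have e2 : ZMod.χ₄ (x : ZMod 4) = -1 := ZMod.χ₄_nat_three_mod_four h1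
        rw [e, neg_mul, jac_mul_self hxs]
        simp only [e2, Int.cast_neg, Int.cast_one]

lemma exists_reciprocity_character {s : ℕ} (hs : Squarefree s) :
    ∃ χ : ℕ → ℝ, (∀ x y, χ (x * y) = χ x * χ y) ∧ (∀ x, |χ x| ≤ 1) ∧
      (∀ x y, x ≡ y [MOD 8] → χ x = χ y) ∧ χ 1 = 1 ∧
      ∀ x, Odd x → x.Coprime s → jac s x * jac x s = χ x := by
  rcases Nat.even_or_odd s with he | ho
  · obtain ⟨u, rfl⟩ := he.two_dvd
    have hu : Odd u := by
      rw [← Nat.not_even_iff_odd]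
      rintro hu
      obtain ⟨v, rfl⟩ := hu.two_dvd
      have := hs 2 ⟨v, by ring⟩
      simp at this
    obtain ⟨χ, h1, h2, h3, h4, h5⟩ := exists_reciprocity_character_of_odd hu
    refine ⟨fun x => ((ZMod.χ₈ (x : ZMod 8) : ℤ) : ℝ) * χ x, ?_, ?_, ?_, ?_, ?_⟩
    · intro x y
      simp only [Nat.cast_mul, _root_.map_mul, Int.cast_mul, h1]
      ring
    · intro x
      have : ∀ u : ZMod 8, |ZMod.χ₈ u| ≤ 1 := by decide
      rw [abs_mul]
      exact mul_le_one₀ (by rw [← Int.cast_abs]; exact_mod_cast this x) (abs_nonneg _) (h2 x)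
    · intro x y hxy
      have : (x : ZMod 8) = y := (ZMod.natCast_eq_natCast_iff _ _ _).2 hxy
      simp only [this, h3 x y hxy]
    · simp [h4]
    · intro x hx hxs
      have hxu : x.Coprime u := hxs.coprime_dvd_right (Dvd.intro_left _ rfl)
      have e1 : jac 2 x = ((ZMod.χ₈ (x : ZMod 8) : ℤ) : ℝ) := by
        unfold jac
        exact_mod_cast congrArg (Int.cast : ℤ → ℝ) (jacobiSym.at_two hx)
      have e2 : jac x 2 = 1 := by
        rw [jac_congr_left (a' := 1) (Nat.odd_iff.1 hx), jac_one_left]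
      rw [jac_mul_left, jac_mul_right x two_ne_zero hu.pos.ne', e1, e2]
      simp only [← h5 x hx hxu]
      ring
  · exact exists_reciprocity_character_of_odd ho

lemma abs_sum_jac_reciprocal_le {s q w : ℕ} (hq : HasSimpleOddPrime q) (hw : w ≠ 0) (hsw : s ∣ w)
    (Z : ℕ) :
    |∑ x ∈ Finset.Icc 1 Z, (if Squarefree (x * w) then jac s x * jac x s * jac q x else 0)| ≤
      24 * q * w.divisors.card * √Z := by
  by_cases hsq : Squarefree w
  swap
  · rw [Finset.sum_eq_zero, abs_zero]
    · positivity
    · intro x _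
      rw [if_neg]
      exact fun h' => hsq (Nat.squarefree_mul_iff.1 h').2.2
  obtain ⟨χ, h1, h2, h3, h4, h5⟩ := exists_reciprocity_character (hsq.squarefree_of_dvd hsw)
  have hosc := hq.isOscillating_denominator h1 h2 h3 h4
  set g : ℕ → ℝ := fun x => if Odd x then χ x * jac q x else 0 with hg
  have hcop : ∀ {x : ℕ}, Squarefree (x * w) → x.Coprime s := fun h =>
    (Nat.squarefree_mul_iff.1 h).1.coprime_dvd_right hsw
  rw [sum_Icc_eq_sum_odd_add_sum_double]
  have hodd : |∑ x ∈ Finset.Icc 1 Z, (if Odd x then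
      (if Squarefree (x * w) then jac s x * jac x s * jac q x else 0) else 0)| ≤
      w.divisors.card * (8 * q : ℕ) * √Z := by
    refine le_of_eq_of_le ?_ (hosc.abs_sum_squarefree_mul_le hw Z)
    congr 1
    refine Finset.sum_congr rfl fun x _ => ?_
    by_cases hx : Odd x
    · by_cases hs : Squarefree (x * w)
      · simp only [hx, hs, if_true, hg, h5 x hx (hcop hs)]
      · simp [hs]
    · simp [hx, hg]
  have heven : |∑ y ∈ Finset.Icc 1 (Z / 2), (if Squarefree (2 * y * w) then
      jac s (2 * y) * jac (2 * y) s * jac q (2 * y) else 0)| ≤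
      (2 * w.divisors.card) * (8 * q : ℕ) * √Z := by
    have hcard : ((2 * w).divisors.card : ℝ) ≤ 2 * w.divisors.card := by
      have := card_divisors_mul_le 2 w
      have e : (Nat.divisors 2).card = 2 := by decide
      rw [e] at this
      exact_mod_cast this
    have hpt : ∑ y ∈ Finset.Icc 1 (Z / 2), (if Squarefree (2 * y * w) then
        jac s (2 * y) * jac (2 * y) s * jac q (2 * y) else 0) =
        (jac s 2 * jac 2 s * jac q 2) *
          ∑ y ∈ Finset.Icc 1 (Z / 2), (if Squarefree (y * (2 * w)) then g y else 0) := by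
      rw [Finset.mul_sum]
      refine Finset.sum_congr rfl fun y hy => ?_
      have hy0 : y ≠ 0 := by have := (Finset.mem_Icc.1 hy).1; omega
      have e : 2 * y * w = y * (2 * w) := by ring
      rw [e]
      by_cases hs : Squarefree (y * (2 * w))
      · have hyw : Squarefree (y * w) := hs.squarefree_of_dvd ⟨2, by ring⟩
        have hyo : Odd y := Nat.Coprime.odd_of_right
          ((Nat.squarefree_mul_iff.1 hs).1.coprime_dvd_right (Dvd.intro _ rfl))
        simp only [hs, if_true, hg, hyo]
        rw [← h5 y hyo (hcop hyw), jac_mul_right _ two_ne_zero hy0, jac_mul_right _ two_ne_zero hy0,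
          jac_mul_left]
        ring
      · simp [hs]
    rw [hpt, abs_mul]
    have hc : |jac s 2 * jac 2 s * jac q 2| ≤ 1 := by
      rw [abs_mul, abs_mul]
      exact mul_le_one₀ (mul_le_one₀ (abs_jac_le_one _ _) (abs_nonneg _) (abs_jac_le_one _ _))
        (abs_nonneg _) (abs_jac_le_one _ _)
    have hZ : √((Z / 2 : ℕ) : ℝ) ≤ √Z := Real.sqrt_le_sqrt (by exact_mod_cast Nat.div_le_self Z 2)
    calc _ ≤ 1 * (((2 * w).divisors.card : ℝ) * (8 * q : ℕ) * √((Z / 2 : ℕ) : ℝ)) := by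
          gcongr
          exact hosc.abs_sum_squarefree_mul_le (by omega) _
      _ ≤ 1 * ((2 * w.divisors.card) * (8 * q : ℕ) * √Z) := by gcongr
      _ = _ := one_mul _
  refine (abs_add_le _ _).trans ((add_le_add hodd heven).trans (le_of_eq ?_))
  push_cast
  ring

lemma abs_sum_jac_numerator_le {q w : ℕ} (hq : HasSimpleOddPrime q) (hw : w ≠ 0) (Z : ℕ) :
    |∑ x ∈ Finset.Icc 1 Z, (if Squarefree (x * w) then jac x q else 0)| ≤
      24 * q * w.divisors.card * √Z := by
  refine (hq.isOscillating_numerator.abs_sum_squarefree_mul_le hw Z).trans ?_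
  have : (0 : ℝ) ≤ q * w.divisors.card * √Z := by positivity
  nlinarith

lemma sum_piFinset_insertNth {n : ℕ} (k : Fin (n + 1)) (P : Fin (n + 1) → Finset ℕ)
    (f : (Fin (n + 1) → ℕ) → ℝ) :
    ∑ t ∈ Fintype.piFinset P, f t =
      ∑ s ∈ Fintype.piFinset (fun i => P (k.succAbove i)), ∑ x ∈ P k, f (k.insertNth x s) := by
  rw [← Finset.sum_product']
  refine Finset.sum_bij' (fun t _ => (fun i => t (k.succAbove i), t k))
    (fun p _ => k.insertNth p.2 p.1) ?_ ?_ ?_ ?_ ?_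
  · intro t ht
    simp only [Fintype.mem_piFinset, Finset.mem_product] at ht ⊢
    exact ⟨fun i => ht _, ht k⟩
  · intro p hp
    simp only [Fintype.mem_piFinset, Finset.mem_product] at hp ⊢
    intro i
    rcases Fin.eq_self_or_eq_succAbove k i with rfl | ⟨j, rfl⟩
    · simpa using hp.2
    · simpa using hp.1 j
  · intro t ht
    exact Fin.insertNth_self_removeNth k t
  · intro p hp
    simp
  · intro t ht
    congr 1
    exact (Fin.insertNth_self_removeNth k t).symm

/-- The product of the three Jacobi symbols, with the variables listed as
`x11, x12, x21, x22, x31, x32`. -/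
noncomputable def jacWeight (t : Fin 6 → ℕ) : ℝ :=
  jac (t 2 * t 3 * t 4 * t 5) (t 0) * jac (t 0 * t 1 * t 4 * t 5) (t 2) *
    jac (t 0 * t 1 * t 2 * t 3) (t 4)

/-- The summand of the sixfold character sum, including the summation conditions. -/
noncomputable def jacTerm (X : ℝ) (t : Fin 6 → ℕ) : ℝ :=
  if Squarefree (∏ i, t i) ∧ ((∏ i, t i : ℕ) : ℝ) ≤ X then jacWeight t else 0

/-- The sixfold character sum over a box. -/
noncomputable def jacSum (X : ℝ) (P : Fin 6 → Finset ℕ) : ℝ :=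
  ∑ t ∈ Fintype.piFinset P, jacTerm X t

lemma abs_jacWeight_le_one (t : Fin 6 → ℕ) : |jacWeight t| ≤ 1 := by
  rw [jacWeight, abs_mul, abs_mul]
  exact mul_le_one₀ (mul_le_one₀ (abs_jac_le_one _ _) (abs_nonneg _) (abs_jac_le_one _ _))
    (abs_nonneg _) (abs_jac_le_one _ _)

lemma jacSum_comp_perm {σ : Equiv.Perm (Fin 6)} (hσ : ∀ t, jacWeight (t ∘ σ) = jacWeight t)
    (X : ℝ) (P : Fin 6 → Finset ℕ) : jacSum X (P ∘ σ) = jacSum X P := by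
  refine Finset.sum_bij' (fun t _ => t ∘ σ.symm) (fun t _ => t ∘ σ) ?_ ?_ ?_ ?_ ?_
  · intro t ht
    simp only [Fintype.mem_piFinset, Function.comp] at ht ⊢
    intro i
    simpa using ht (σ.symm i)
  · intro t ht
    simp only [Fintype.mem_piFinset, Function.comp] at ht ⊢
    exact fun i => ht (σ i)
  · intro t _
    ext i
    simp
  · intro t _
    ext i
    simp
  · intro t _
    have h1 : ∏ i, (t ∘ σ.symm) i = ∏ i, t i := Equiv.prod_comp σ.symm t
    have h2 : jacWeight (t ∘ σ.symm) = jacWeight t := by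
      rw [← hσ]
      congr 1
      ext i
      simp
    rw [jacTerm, jacTerm, h1, h2]

lemma jacWeight_comp_swap_left (t : Fin 6 → ℕ) :
    jacWeight (t ∘ (Equiv.swap 0 2 * Equiv.swap 1 3 : Equiv.Perm (Fin 6))) = jacWeight t := by
  set σ : Equiv.Perm (Fin 6) := Equiv.swap 0 2 * Equiv.swap 1 3 with hσ
  have h0 : σ 0 = 2 := by rw [hσ]; decide
  have h1 : σ 1 = 3 := by rw [hσ]; decide
  have h2 : σ 2 = 0 := by rw [hσ]; decide
  have h3 : σ 3 = 1 := by rw [hσ]; decide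
  have h4 : σ 4 = 4 := by rw [hσ]; decide
  have h5 : σ 5 = 5 := by rw [hσ]; decide
  simp only [jacWeight, Function.comp, h0, h1, h2, h3, h4, h5, jac_mul_left]
  ring

lemma jacWeight_comp_swap_right (t : Fin 6 → ℕ) :
    jacWeight (t ∘ (Equiv.swap 2 4 * Equiv.swap 3 5 : Equiv.Perm (Fin 6))) = jacWeight t := by
  set σ : Equiv.Perm (Fin 6) := Equiv.swap 2 4 * Equiv.swap 3 5 with hσ
  have h0 : σ 0 = 0 := by rw [hσ]; decide
  have h1 : σ 1 = 1 := by rw [hσ]; decide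
  have h2 : σ 2 = 4 := by rw [hσ]; decide
  have h3 : σ 3 = 5 := by rw [hσ]; decide
  have h4 : σ 4 = 2 := by rw [hσ]; decide
  have h5 : σ 5 = 3 := by rw [hσ]; decide
  simp only [jacWeight, Function.comp, h0, h1, h2, h3, h4, h5, jac_mul_left]
  ring

lemma jacWeight_comp_mul {σ ρ : Equiv.Perm (Fin 6)} (hσ : ∀ t, jacWeight (t ∘ σ) = jacWeight t)
    (hρ : ∀ t, jacWeight (t ∘ ρ) = jacWeight t) (t : Fin 6 → ℕ) :
    jacWeight (t ∘ (σ * ρ : Equiv.Perm (Fin 6))) = jacWeight t := by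
  rw [Equiv.Perm.coe_mul, ← Function.comp_assoc, hρ, hσ]

/-- The sum of the reciprocals of a finite set of natural numbers. -/
noncomputable def recipSum (P : Finset ℕ) : ℝ := ∑ x ∈ P, (x : ℝ)⁻¹

lemma recipSum_nonneg (P : Finset ℕ) : 0 ≤ recipSum P :=
  Finset.sum_nonneg fun _ _ => by positivity

lemma recipSum_le_of_le {P : Finset ℕ} {V : ℝ} (hV : 1 ≤ V) (h : ∀ x ∈ P, 1 ≤ x ∧ (x : ℝ) ≤ V) :
    recipSum P ≤ 1 + log V := by
  have hsub : P ⊆ Finset.Icc 1 ⌊V⌋₊ := fun x hx =>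
    Finset.mem_Icc.2 ⟨(h x hx).1, Nat.le_floor (h x hx).2⟩
  refine (Finset.sum_le_sum_of_subset_of_nonneg hsub fun _ _ _ => by positivity).trans ?_
  refine (sum_inv_le_one_add_log _).trans ?_
  have h1 : (0 : ℝ) < ⌊V⌋₊ := by exact_mod_cast Nat.floor_pos.2 hV
  gcongr
  exact Nat.floor_le (by linarith)

lemma sum_piFinset_inv_prod {n : ℕ} (P : Fin n → Finset ℕ) :
    ∑ s ∈ Fintype.piFinset P, ((∏ i, s i : ℕ) : ℝ)⁻¹ = ∏ i, recipSum (P i) := by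
  simp only [recipSum]
  rw [Finset.prod_univ_sum]
  refine Finset.sum_congr rfl fun s _ => ?_
  push_cast
  rw [Finset.prod_inv_distrib]

lemma prod_insertNth {n : ℕ} (k : Fin (n + 1)) (x : ℕ) (s : Fin n → ℕ) :
    ∏ i, (k.insertNth x s : Fin (n + 1) → ℕ) i = x * ∏ i, s i := by
  rw [Fin.prod_univ_succAbove _ k]
  simp

lemma abs_jacSum_le_trivial {X : ℝ} (hX : 0 ≤ X) {P : Fin 6 → Finset ℕ}
    (hP : ∀ i, ∀ x ∈ P i, 1 ≤ x) (k : Fin 6) :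
    |jacSum X P| ≤ X * ∏ i, recipSum (P (k.succAbove i)) := by
  rw [jacSum, sum_piFinset_insertNth k, ← sum_piFinset_inv_prod, Finset.mul_sum]
  refine (Finset.abs_sum_le_sum_abs _ _).trans (Finset.sum_le_sum fun s hs => ?_)
  have hw : 0 < ∏ i, s i := Finset.prod_pos fun i _ => hP _ _ (Fintype.mem_piFinset.1 hs i)
  have hw' : (0 : ℝ) < (∏ i, s i : ℕ) := by exact_mod_cast hw
  set w := ∏ i, s i with hwdef
  calc |∑ x ∈ P k, jacTerm X (k.insertNth x s)|
      ≤ ∑ x ∈ P k, |jacTerm X (k.insertNth x s)| := Finset.abs_sum_le_sum_abs _ _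
    _ ≤ ∑ x ∈ P k, (if x ∈ Finset.Icc 1 ⌊X / w⌋₊ then 1 else 0) := by
        refine Finset.sum_le_sum fun x hx => ?_
        rw [jacTerm, prod_insertNth, ← hwdef]
        split_ifs with h1 h2 h2
        · exact abs_jacWeight_le_one _
        · refine absurd (Finset.mem_Icc.2 ⟨hP k x hx, Nat.le_floor ?_⟩) h2
          rw [le_div_iff₀ hw']
          exact_mod_cast h1.2
        · simp
        · simp
    _ ≤ (Finset.Icc 1 ⌊X / w⌋₊).card := by
        rw [← Finset.sum_filter, Finset.sum_const, nsmul_eq_mul, mul_one]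
        refine Nat.cast_le.2 (Finset.card_le_card fun x hx => (Finset.mem_filter.1 hx).2)
    _ ≤ X * (w : ℝ)⁻¹ := by
        rw [Nat.card_Icc, Nat.add_sub_cancel, ← div_eq_mul_inv]
        exact Nat.floor_le (by positivity)

lemma squarefree_mul_mul_iff {m n w : ℕ} :
    Squarefree (m * (n * w)) ↔ Squarefree (m * w) ∧ Squarefree (n * w) ∧ n.Coprime m := by
  simp only [Nat.squarefree_mul_iff, Nat.coprime_mul_iff_right]
  rw [Nat.coprime_comm (m := n) (n := m)]
  tauto

lemma prod_six (a b c d e f : ℕ) : ∏ i, ![a, b, c, d, e, f] i = a * b * c * d * e * f := by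
  simp [Fin.prod_univ_succ, mul_assoc]

lemma jacWeight_six (a b c d e f : ℕ) :
    jacWeight ![a, b, c, d, e, f] =
      jac (c * d * e * f) a * jac (a * b * e * f) c * jac (a * b * c * d) e := rfl

lemma abs_sum_jacTerm_bilinear_le {X : ℝ} (hX : 0 < X) (hℓ : 1 ≤ log X) {M N : Finset ℕ}
    (hM : ∀ m ∈ M, m ∈ Finset.Icc 1 ⌊X⌋₊ ∧ log X ^ 96 < m)
    (hN : ∀ n ∈ N, n ∈ Finset.Icc 1 ⌊X⌋₊ ∧ log X ^ 96 < n)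
    {b c e f : ℕ} (hb : 0 < b) (hc : 0 < c) (he : 0 < e) (hf : 0 < f) :
    |∑ n ∈ N, ∑ m ∈ M, jacTerm X ![m, b, c, n, e, f]| ≤
      131 * X / log X ^ 5 * ((b * c * e * f : ℕ) : ℝ)⁻¹ := by
  set w := b * c * e * f with hw
  have hw0 : 0 < w := by positivity
  have hw1 : (1 : ℝ) ≤ w := by exact_mod_cast hw0
  have hw' : (0 : ℝ) < w := by linarith
  set K := jac (b * e * f) c * jac (b * c) e with hK
  set α : ℕ → ℝ := fun m =>
    if m ∈ M ∧ Squarefree (m * w) then K * jac (c * e * f) m * jac m c * jac m e else 0 with hα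
  set β : ℕ → ℝ := fun n => if n ∈ N ∧ Squarefree (n * w) then jac n e else 0 with hβ
  have hKα : ∀ m, |K * jac (c * e * f) m * jac m c * jac m e| ≤ 1 := by
    intro m
    rw [hK]
    simp only [abs_mul]
    have h := abs_jac_le_one
    exact mul_le_one₀ (mul_le_one₀ (mul_le_one₀ (mul_le_one₀ (h _ _) (abs_nonneg _) (h _ _))
      (abs_nonneg _) (h _ _)) (abs_nonneg _) (h _ _)) (abs_nonneg _) (h _ _)
  have hα1 : ∀ m, |α m| ≤ 1 := by
    intro m
    simp only [hα]
    split_ifs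
    · exact hKα m
    · simp
  have hβ1 : ∀ n, |β n| ≤ 1 := by
    intro n
    simp only [hβ]
    split_ifs
    · exact abs_jac_le_one _ _
    · simp
  have hα2 : ∀ m, α m ≠ 0 → Squarefree m ∧ log X ^ 96 < m := by
    intro m hm
    have : m ∈ M ∧ Squarefree (m * w) := by
      by_contra h
      exact hm (if_neg h)
    exact ⟨(Nat.squarefree_mul_iff.1 this.2).2.1, (hM m this.1).2⟩
  have hβ2 : ∀ n, β n ≠ 0 → Squarefree n ∧ log X ^ 96 < n := by
    intro n hn
    have : n ∈ N ∧ Squarefree (n * w) := by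
      by_contra h
      exact hn (if_neg h)
    exact ⟨(Nat.squarefree_mul_iff.1 this.2).2.1, (hN n this.1).2⟩
  have hterm : ∀ m ∈ M, ∀ n ∈ N, jacTerm X ![m, b, c, n, e, f] =
      if (m : ℝ) * n ≤ X / w then α m * β n * jac n m else 0 := by
    intro m hm n hn
    have hm0 : m ≠ 0 := by
      have := (Finset.mem_Icc.1 (hM m hm).1).1
      omega
    have hprod : ∏ i, ![m, b, c, n, e, f] i = m * (n * w) := by
      rw [prod_six, hw]
      ring
    have hle : ((m * (n * w) : ℕ) : ℝ) ≤ X ↔ (m : ℝ) * n ≤ X / w := by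
      rw [le_div_iff₀ hw']
      push_cast
      rw [mul_assoc]
    rw [jacTerm, hprod, jacWeight_six]
    simp only [hle, squarefree_mul_mul_iff]
    by_cases h1 : (m : ℝ) * n ≤ X / w
    · by_cases h2 : Squarefree (m * w)
      · by_cases h3 : Squarefree (n * w)
        · by_cases h4 : n.Coprime m
          · rw [if_pos ⟨⟨h2, h3, h4⟩, h1⟩, if_pos h1]
            simp only [h2, h3, and_self, if_true, hα, hβ, hm, hn, hK, jac_mul_left]
            ring
          · simp [h4, jac_eq_zero hm0 h4]
        · simp [h3, hβ]
      · simp [h2, hα]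
    · simp [h1]
  have hMsub : M ⊆ Finset.Icc 1 ⌊X⌋₊ := fun m hm => (hM m hm).1
  have hNsub : N ⊆ Finset.Icc 1 ⌊X⌋₊ := fun n hn => (hN n hn).1
  have hY : log (X / w) ≤ log X := log_le_log (by positivity) (div_le_self hX.le hw1)
  have main := bilinear_jac_hyperbola_le hα1 hβ1 hℓ (div_pos hX hw') hY hα2 hβ2 ⌊X⌋₊
  have hsum : ∑ n ∈ N, ∑ m ∈ M, jacTerm X ![m, b, c, n, e, f] =
      ∑ m ∈ Finset.Icc 1 ⌊X⌋₊, ∑ n ∈ Finset.Icc 1 ⌊X⌋₊,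
        (if (m : ℝ) * n ≤ X / w then α m * β n * jac n m else 0) := by
    rw [Finset.sum_comm]
    rw [← Finset.sum_subset hMsub]
    · refine Finset.sum_congr rfl fun m hm => ?_
      rw [← Finset.sum_subset hNsub]
      · exact Finset.sum_congr rfl fun n hn => hterm m hm n hn
      · intro n _ hn
        simp [hβ, hn]
    · intro m _ hm
      exact Finset.sum_eq_zero fun n _ => by simp [hα, hm]
  rw [hsum]
  refine main.trans (le_of_eq ?_)
  field_simp

lemma abs_jacSum_le_of_zero_three {X : ℝ} (hX : 0 < X) (hℓ : 1 ≤ log X) {P : Fin 6 → Finset ℕ}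
    (hP : ∀ i, ∀ x ∈ P i, x ∈ Finset.Icc 1 ⌊X⌋₊)
    (h0 : ∀ x ∈ P 0, log X ^ 96 < x) (h3 : ∀ x ∈ P 3, log X ^ 96 < x) :
    |jacSum X P| ≤ 2096 * X := by
  have hX1 : 1 ≤ X := by
    by_contra h
    have := log_nonpos hX.le (not_le.1 h).le
    linarith
  have hsplit : jacSum X P = ∑ z ∈ Fintype.piFinset
      (fun i : Fin 4 => P ((0 : Fin 6).succAbove ((2 : Fin 5).succAbove i))),
      ∑ n ∈ P 3, ∑ m ∈ P 0, jacTerm X ![m, z 0, z 1, n, z 2, z 3] := by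
    rw [jacSum, sum_piFinset_insertNth 0, sum_piFinset_insertNth 2]
    refine Finset.sum_congr rfl fun z _ => Finset.sum_congr rfl fun n _ =>
      Finset.sum_congr rfl fun m _ => ?_
    congr 1
    ext i
    fin_cases i <;> rfl
  rw [hsplit]
  have hrec : ∀ i, recipSum (P i) ≤ 2 * log X := by
    intro i
    have := recipSum_le_of_le (P := P i) hX1 (fun x hx => by
      have h := Finset.mem_Icc.1 (hP i x hx)
      exact ⟨h.1, (Nat.le_floor_iff hX.le).1 h.2⟩)
    linarith
  have hpos : ∀ i, ∀ x ∈ P i, 0 < x := fun i x hx => (Finset.mem_Icc.1 (hP i x hx)).1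
  calc _ ≤ ∑ z ∈ Fintype.piFinset
        (fun i : Fin 4 => P ((0 : Fin 6).succAbove ((2 : Fin 5).succAbove i))),
        131 * X / log X ^ 5 * ((∏ i, z i : ℕ) : ℝ)⁻¹ := by
        refine (Finset.abs_sum_le_sum_abs _ _).trans (Finset.sum_le_sum fun z hz => ?_)
        have hz' := fun i => hpos _ _ (Fintype.mem_piFinset.1 hz i)
        refine (abs_sum_jacTerm_bilinear_le hX hℓ (fun m hm => ⟨hP 0 m hm, h0 m hm⟩)
          (fun n hn => ⟨hP 3 n hn, h3 n hn⟩) (hz' 0) (hz' 1) (hz' 2) (hz' 3)).trans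
          (le_of_eq ?_)
        congr 3
        simp [Fin.prod_univ_succ, mul_assoc]
    _ = 131 * X / log X ^ 5 *
        ∏ i : Fin 4, recipSum (P ((0 : Fin 6).succAbove ((2 : Fin 5).succAbove i))) := by
        rw [← Finset.mul_sum, sum_piFinset_inv_prod]
    _ ≤ 131 * X / log X ^ 5 * ∏ i : Fin 4, (2 * log X) := by
        gcongr
        · exact fun _ _ => recipSum_nonneg _
        · exact hrec _
    _ = 2096 * X / log X := by
        rw [Finset.prod_const, Finset.card_univ, Fintype.card_fin]
        field_simp
        ring
    _ ≤ 2096 * X := div_le_self (by positivity) hℓ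

lemma abs_jacSum_le_of_linked {X : ℝ} (hX : 0 < X) (hℓ : 1 ≤ log X) {P : Fin 6 → Finset ℕ}
    (hP : ∀ i, ∀ x ∈ P i, x ∈ Finset.Icc 1 ⌊X⌋₊) {σ : Equiv.Perm (Fin 6)}
    (hσ : ∀ t, jacWeight (t ∘ σ) = jacWeight t)
    (h0 : ∀ x ∈ P (σ 0), log X ^ 96 < x) (h3 : ∀ x ∈ P (σ 3), log X ^ 96 < x) :
    |jacSum X P| ≤ 2096 * X := by
  rw [← jacSum_comp_perm hσ]
  exact abs_jacSum_le_of_zero_three hX hℓ (fun i => hP (σ i)) h0 h3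

/-- The pairs of coordinates linked by a Jacobi symbol that occurs without its reciprocal. -/
lemma exists_symmetry_of_linked {i j : Fin 6}
    (h : (i = 0 ∧ j = 3) ∨ (i = 2 ∧ j = 1) ∨ (i = 4 ∧ j = 3) ∨ (i = 0 ∧ j = 5) ∨
      (i = 2 ∧ j = 5) ∨ (i = 4 ∧ j = 1)) :
    ∃ σ : Equiv.Perm (Fin 6), (∀ t, jacWeight (t ∘ σ) = jacWeight t) ∧ σ 0 = i ∧ σ 3 = j := by
  have hs := jacWeight_comp_swap_left
  have hr := jacWeight_comp_swap_right
  rcases h with ⟨rfl, rfl⟩ | ⟨rfl, rfl⟩ | ⟨rfl, rfl⟩ | ⟨rfl, rfl⟩ | ⟨rfl, rfl⟩ | ⟨rfl, rfl⟩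
  · exact ⟨1, fun t => rfl, rfl, rfl⟩
  · exact ⟨_, hs, by decide, by decide⟩
  · exact ⟨_, jacWeight_comp_mul hr (jacWeight_comp_mul hs hr), by decide, by decide⟩
  · exact ⟨_, hr, by decide, by decide⟩
  · exact ⟨_, jacWeight_comp_mul hs hr, by decide, by decide⟩
  · exact ⟨_, jacWeight_comp_mul hr hs, by decide, by decide⟩

lemma abs_sum_filter_gt_le {h : ℕ → ℝ} {D : ℝ} (hD : 0 ≤ D)
    (hh : ∀ Z : ℕ, |∑ x ∈ Finset.Icc 1 Z, h x| ≤ D * √Z) {X V : ℝ} (hX : 0 < X) (hV : 0 < V)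
    {w : ℕ} (hw : 0 < w) {P : Finset ℕ}
    (hP : ∀ x, x ∈ P ↔ x ∈ Finset.Icc 1 ⌊X⌋₊ ∧ V < x) :
    |∑ x ∈ P, (if ((x * w : ℕ) : ℝ) ≤ X then h x else 0)| ≤ 2 * D * (X / w) / √V := by
  have hw1 : (1 : ℝ) ≤ w := by exact_mod_cast hw
  have hw' : (0 : ℝ) < w := by linarith
  have hY : 0 < X / w := by positivity
  have hle : ∀ x : ℕ, ((x * w : ℕ) : ℝ) ≤ X ↔ (x : ℝ) ≤ X / w := fun x => by
    rw [le_div_iff₀ hw', Nat.cast_mul]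
  simp only [hle]
  rcases le_or_gt (X / w) V with hc | hc
  · rw [Finset.sum_eq_zero, abs_zero]
    · positivity
    · intro x hx
      rw [if_neg]
      exact fun h' => absurd ((hP x).1 hx).2 (not_lt.2 (h'.trans hc))
  · have hfl : ⌊V⌋₊ ≤ ⌊X / w⌋₊ := Nat.floor_mono hc.le
    have hset : P.filter (fun x : ℕ => (x : ℝ) ≤ X / w) =
        Finset.Icc 1 ⌊X / w⌋₊ \ Finset.Icc 1 ⌊V⌋₊ := by
      ext x
      simp only [Finset.mem_filter, hP, Finset.mem_sdiff, Finset.mem_Icc, Nat.le_floor_iff hX.le,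
        Nat.le_floor_iff hY.le, Nat.le_floor_iff hV.le]
      constructor
      · rintro ⟨⟨⟨h1, h2⟩, h3⟩, h4⟩
        exact ⟨⟨h1, h4⟩, fun h => absurd h3 (not_lt.2 h.2)⟩
      · rintro ⟨⟨h1, h2⟩, h3⟩
        exact ⟨⟨⟨h1, h2.trans (div_le_self hX.le hw1)⟩, not_le.1 fun h => h3 ⟨h1, h⟩⟩, h2⟩
    rw [← Finset.sum_filter, hset,
      Finset.sum_sdiff_eq_sub (Finset.Icc_subset_Icc_right hfl)]
    have h1 : √(⌊X / w⌋₊ : ℝ) ≤ √(X / w) := sqrt_le_sqrt (Nat.floor_le hY.le)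
    have h2 : √(⌊V⌋₊ : ℝ) ≤ √(X / w) := sqrt_le_sqrt ((Nat.floor_le hV.le).trans hc.le)
    have h3 : √(X / w) ≤ X / w / √V := by
      rw [le_div_iff₀ (sqrt_pos.2 hV)]
      calc √(X / w) * √V ≤ √(X / w) * √(X / w) := by
            gcongr
        _ = X / w := mul_self_sqrt hY.le
    calc _ ≤ D * √(⌊X / w⌋₊ : ℝ) + D * √(⌊V⌋₊ : ℝ) :=
          (abs_sub _ _).trans (add_le_add (hh _) (hh _))
      _ ≤ D * (X / w / √V) + D * (X / w / √V) := by
          gcongr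
          · exact h1.trans h3
          · exact h2.trans h3
      _ = _ := by ring

lemma card_divisors_prod_le {ι : Type*} (S : Finset ι) (s : ι → ℕ) :
    (∏ i ∈ S, s i).divisors.card ≤ ∏ i ∈ S, (s i).divisors.card :=
  Finset.le_prod_of_submultiplicative (fun n : ℕ => n.divisors.card) (by simp)
    card_divisors_mul_le S s

lemma sum_card_divisors_div_le {X : ℝ} (hX : 1 ≤ X) {P : Finset ℕ}
    (hP : ∀ x ∈ P, x ∈ Finset.Icc 1 ⌊X⌋₊) :
    ∑ x ∈ P, (x.divisors.card : ℝ) / x ≤ (1 + log X) ^ 2 := by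
  have h1 := sum_card_divisors_pow_div_le ⌊X⌋₊ 1
  simp only [pow_one] at h1
  have h0 : (0 : ℝ) < ⌊X⌋₊ := by exact_mod_cast Nat.floor_pos.2 hX
  refine (Finset.sum_le_sum_of_subset_of_nonneg (fun x hx => hP x hx)
    fun _ _ _ => by positivity).trans (h1.trans ?_)
  gcongr
  refine (sum_inv_le_one_add_log _).trans ?_
  gcongr
  exact Nat.floor_le (by linarith)

lemma abs_jacSum_le_of_linear {X V A : ℝ} (hX : 1 ≤ X) (hV : 0 < V) (hA : 0 ≤ A)
    {P : Fin 6 → Finset ℕ} (hP : ∀ i, ∀ x ∈ P i, x ∈ Finset.Icc 1 ⌊X⌋₊) (k : Fin 6)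
    (hk : ∀ x, x ∈ P k ↔ x ∈ Finset.Icc 1 ⌊X⌋₊ ∧ V < x)
    (hlin : ∀ s ∈ Fintype.piFinset (fun i => P (k.succAbove i)), ∀ Z : ℕ,
      |∑ x ∈ Finset.Icc 1 Z,
        (if Squarefree (x * ∏ i, s i) then jacWeight (k.insertNth x s) else 0)| ≤
        A * (∏ i, s i).divisors.card * √Z) :
    |jacSum X P| ≤ 2 * A * X / √V * (1 + log X) ^ 10 := by
  have hX0 : 0 < X := by linarith
  rw [jacSum, sum_piFinset_insertNth k]
  calc _ ≤ ∑ s ∈ Fintype.piFinset (fun i => P (k.succAbove i)),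
        2 * A * X / √V * ∏ i, (((s i).divisors.card : ℝ) / s i) := by
        refine (Finset.abs_sum_le_sum_abs _ _).trans (Finset.sum_le_sum fun s hs => ?_)
        have hw : 0 < ∏ i, s i := Finset.prod_pos fun i _ =>
          (Finset.mem_Icc.1 (hP _ _ (Fintype.mem_piFinset.1 hs i))).1
        have hterm : ∀ x ∈ P k, jacTerm X (k.insertNth x s) =
            if ((x * ∏ i, s i : ℕ) : ℝ) ≤ X then
              (if Squarefree (x * ∏ i, s i) then jacWeight (k.insertNth x s) else 0) else 0 := by
          intro x _
          rw [jacTerm, prod_insertNth]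
          split_ifs <;> tauto
        rw [Finset.sum_congr rfl hterm]
        refine (abs_sum_filter_gt_le (by positivity) (hlin s hs) hX0 hV hw hk).trans ?_
        have hdiv : ((∏ i, s i).divisors.card : ℝ) ≤ ∏ i, ((s i).divisors.card : ℝ) := by
          exact_mod_cast card_divisors_prod_le Finset.univ s
        calc _ = 2 * A * X / √V * (((∏ i, s i).divisors.card : ℝ) / (∏ i, s i : ℕ)) := by ring
          _ ≤ 2 * A * X / √V * ((∏ i, ((s i).divisors.card : ℝ)) / (∏ i, s i : ℕ)) := by gcongr
          _ = _ := by rw [Finset.prod_div_distrib, Nat.cast_prod]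
    _ = 2 * A * X / √V * ∏ i, ∑ x ∈ P (k.succAbove i), ((x.divisors.card : ℝ) / x) := by
        rw [← Finset.mul_sum, Finset.prod_univ_sum]
    _ ≤ 2 * A * X / √V * ∏ i : Fin 5, (1 + log X) ^ 2 := by
        gcongr
        exact sum_card_divisors_div_le hX (hP _)
    _ = _ := by
        rw [Finset.prod_const, Finset.card_univ, Fintype.card_fin]
        ring

lemma hasSimpleOddPrime_of_squarefree_mul {a b : ℕ} (ha : 1 < a) (hb : 1 < b)
    (h : Squarefree (a * b)) : HasSimpleOddPrime (a * b) := by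
  obtain ⟨h1, h2, h3⟩ := Nat.squarefree_mul_iff.1 h
  refine hasSimpleOddPrime_mul h2 h3 ?_ ?_ ?_
  · rintro rfl
    rw [Nat.coprime_self] at h1
    omega
  · rintro rfl
    have := h1.symm.eq_one_of_dvd (Dvd.intro_left _ rfl)
    omega
  · rintro rfl
    have := h1.eq_one_of_dvd (Dvd.intro_left _ rfl)
    omega

lemma abs_sum_ite_mul_le {p : ℕ → Prop} [DecidablePred p] {f g : ℕ → ℝ} {K B : ℝ} (hK : |K| ≤ 1)
    (I : Finset ℕ) (hfg : ∀ x ∈ I, p x → f x = K * g x)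
    (hB : |∑ x ∈ I, (if p x then g x else 0)| ≤ B) :
    |∑ x ∈ I, (if p x then f x else 0)| ≤ B := by
  have : ∑ x ∈ I, (if p x then f x else 0) = K * ∑ x ∈ I, (if p x then g x else 0) := by
    rw [Finset.mul_sum]
    refine Finset.sum_congr rfl fun x hx => ?_
    split_ifs with h
    · exact hfg x hx h
    · simp
  rw [this, abs_mul]
  calc _ ≤ 1 * B := mul_le_mul hK hB (abs_nonneg _) zero_le_one
    _ = B := one_mul B

lemma abs_jac_mul_jac_le_one (a b c d : ℕ) : |jac a b * jac c d| ≤ 1 := by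
  rw [abs_mul]
  exact mul_le_one₀ (abs_jac_le_one _ _) (abs_nonneg _) (abs_jac_le_one _ _)

lemma abs_sum_jacWeight_cons_le {L : ℝ} {s : Fin 5 → ℕ} (hs : ∀ i, 0 < s i)
    (h2 : 1 < s 2 ∧ (s 2 : ℝ) ≤ L) (h4 : 1 < s 4 ∧ (s 4 : ℝ) ≤ L) (Z : ℕ) :
    |∑ x ∈ Finset.Icc 1 Z,
      (if Squarefree (x * ∏ i, s i) then jacWeight ((0 : Fin 6).insertNth x s) else 0)| ≤
      24 * L ^ 2 * (∏ i, s i).divisors.card * √Z := by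
  by_cases hsq : Squarefree (∏ i, s i)
  swap
  · rw [Finset.sum_eq_zero, abs_zero]
    · positivity
    · intro x _
      rw [if_neg]
      exact fun h' => hsq (Nat.squarefree_mul_iff.1 h').2.2
  have hprod : ∏ i, s i = s 0 * s 1 * s 2 * s 3 * s 4 := by
    simp [Fin.prod_univ_succ, mul_assoc]
  have hw : ∏ i, s i ≠ 0 := (Finset.prod_pos fun i _ => hs i).ne'
  have hq : HasSimpleOddPrime (s 2 * s 4) := by
    refine hasSimpleOddPrime_of_squarefree_mul h2.1 h4.1 (hsq.squarefree_of_dvd ?_)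
    rw [hprod]
    exact ⟨s 0 * s 1 * s 3, by ring⟩
  have hd : s 1 * s 3 ∣ ∏ i, s i := by
    rw [hprod]
    exact ⟨s 0 * s 2 * s 4, by ring⟩
  have hqL : ((s 2 * s 4 : ℕ) : ℝ) ≤ L ^ 2 := by
    have : (0 : ℝ) ≤ L := (Nat.cast_nonneg _).trans h2.2
    rw [Nat.cast_mul, sq]
    exact mul_le_mul h2.2 h4.2 (Nat.cast_nonneg _) this
  refine abs_sum_ite_mul_le (abs_jac_mul_jac_le_one (s 0 * s 3 * s 4) (s 1) (s 0 * s 1 * s 2) (s 3))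
    _ ?_ ((abs_sum_jac_reciprocal_le hq hw hd Z).trans (by gcongr))
  intro x _ _
  have e : ((0 : Fin 6).insertNth x s : Fin 6 → ℕ) = ![x, s 0, s 1, s 2, s 3, s 4] := by
    ext i
    fin_cases i <;> rfl
  rw [e, jacWeight_six, jac_mul_right x (hs 1).ne' (hs 3).ne']
  simp only [jac_mul_left]
  ring

lemma abs_sum_jacWeight_insertNth_one_le {L : ℝ} {s : Fin 5 → ℕ} (hs : ∀ i, 0 < s i)
    (h1 : 1 < s 1 ∧ (s 1 : ℝ) ≤ L) (h3 : 1 < s 3 ∧ (s 3 : ℝ) ≤ L) (Z : ℕ) :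
    |∑ x ∈ Finset.Icc 1 Z,
      (if Squarefree (x * ∏ i, s i) then jacWeight ((1 : Fin 6).insertNth x s) else 0)| ≤
      24 * L ^ 2 * (∏ i, s i).divisors.card * √Z := by
  by_cases hsq : Squarefree (∏ i, s i)
  swap
  · rw [Finset.sum_eq_zero, abs_zero]
    · positivity
    · intro x _
      rw [if_neg]
      exact fun h' => hsq (Nat.squarefree_mul_iff.1 h').2.2
  have hprod : ∏ i, s i = s 0 * s 1 * s 2 * s 3 * s 4 := by
    simp [Fin.prod_univ_succ, mul_assoc]
  have hw : ∏ i, s i ≠ 0 := (Finset.prod_pos fun i _ => hs i).ne'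
  have hq : HasSimpleOddPrime (s 1 * s 3) := by
    refine hasSimpleOddPrime_of_squarefree_mul h1.1 h3.1 (hsq.squarefree_of_dvd ?_)
    rw [hprod]
    exact ⟨s 0 * s 2 * s 4, by ring⟩
  have hqL : ((s 1 * s 3 : ℕ) : ℝ) ≤ L ^ 2 := by
    have : (0 : ℝ) ≤ L := (Nat.cast_nonneg _).trans h1.2
    rw [Nat.cast_mul, sq]
    exact mul_le_mul h1.2 h3.2 (Nat.cast_nonneg _) this
  refine abs_sum_ite_mul_le (K := jac (s 1 * s 2 * s 3 * s 4) (s 0) *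
    (jac (s 0 * s 3 * s 4) (s 1) * jac (s 0 * s 1 * s 2) (s 3))) ?_
    _ ?_ ((abs_sum_jac_numerator_le hq hw Z).trans (by gcongr))
  · rw [abs_mul]
    exact mul_le_one₀ (abs_jac_le_one _ _) (abs_nonneg _) (abs_jac_mul_jac_le_one _ _ _ _)
  intro x _ _
  have e : ((1 : Fin 6).insertNth x s : Fin 6 → ℕ) = ![s 0, x, s 1, s 2, s 3, s 4] := by
    ext i
    fin_cases i <;> rfl
  rw [e, jacWeight_six, jac_mul_right x (hs 1).ne' (hs 3).ne']
  simp only [jac_mul_left]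
  ring

/-- The size class of `x` relative to the two thresholds `u` and `v`. -/
noncomputable def sizeClass (u v : ℝ) (x : ℕ) : Fin 3 :=
  if (x : ℝ) ≤ u then 0 else if (x : ℝ) ≤ v then 1 else 2

lemma sizeClass_eq_zero {u v : ℝ} {x : ℕ} (h : sizeClass u v x = 0) : (x : ℝ) ≤ u := by
  unfold sizeClass at h
  split_ifs at h with h1 h2
  · exact h1
  · exact absurd h (by decide)
  · exact absurd h (by decide)

lemma lt_of_sizeClass_ne_zero {u v : ℝ} {x : ℕ} (h : sizeClass u v x ≠ 0) : u < x := by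
  by_contra h1
  exact h (if_pos (not_lt.1 h1))

lemma le_of_sizeClass_ne_two {u v : ℝ} (huv : u ≤ v) {x : ℕ} (h : sizeClass u v x ≠ 2) :
    (x : ℝ) ≤ v := by
  unfold sizeClass at h
  split_ifs at h with h1 h2
  · exact h1.trans huv
  · exact h2
  · exact absurd rfl h

lemma sizeClass_eq_two_iff {u v : ℝ} (huv : u ≤ v) {x : ℕ} : sizeClass u v x = 2 ↔ v < x := by
  constructor
  · intro h
    by_contra h1
    unfold sizeClass at h
    rw [not_lt] at h1
    split_ifs at h
    · exact absurd h (by decide)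
    · exact absurd h (by decide)
  · intro h
    rw [sizeClass, if_neg (not_le.2 (huv.trans_lt h)), if_neg (not_le.2 h)]

lemma jacSum_eq_sum_sizeClass (X : ℝ) (I : Finset ℕ) (c : ℕ → Fin 3) :
    jacSum X (fun _ => I) =
      ∑ b : Fin 6 → Fin 3, jacSum X (fun i => I.filter (fun x => c x = b i)) := by
  rw [jacSum, ← Finset.sum_fiberwise _ (fun (t : Fin 6 → ℕ) (i : Fin 6) => c (t i))]
  refine Finset.sum_congr rfl fun b _ => ?_
  rw [jacSum]
  refine Finset.sum_congr ?_ fun _ _ => rfl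
  ext t
  simp only [Finset.mem_filter, Fintype.mem_piFinset, funext_iff, forall_and]

lemma sizeClass_pattern : ∀ b0 b1 b2 b3 b4 b5 : Fin 3,
    (b0 ≠ 0 ∧ b3 ≠ 0) ∨ (b2 ≠ 0 ∧ b1 ≠ 0) ∨ (b4 ≠ 0 ∧ b3 ≠ 0) ∨ (b0 ≠ 0 ∧ b5 ≠ 0) ∨
    (b2 ≠ 0 ∧ b5 ≠ 0) ∨ (b4 ≠ 0 ∧ b1 ≠ 0) ∨
    (∃ k : Fin 6, ∃ j : Fin 5, ∀ i : Fin 4,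
      ![b0, b1, b2, b3, b4, b5] (k.succAbove (j.succAbove i)) ≠ 2) ∨
    (b0 = 2 ∧ b3 = 0 ∧ b5 = 0) ∨ (b1 = 2 ∧ b2 = 0 ∧ b4 = 0) := by
  decide

lemma one_add_log_pow_le {ℓ : ℝ} (hℓ : 1 ≤ ℓ) : 1 + log (ℓ ^ 500) ≤ 2287 * ℓ ^ ((7 : ℝ) / 32) := by
  have h1 := log_le_rpow_div (x := ℓ) (by linarith) (ε := (7 : ℝ) / 32) (by norm_num)
  have h2 := one_le_rpow hℓ (z := (7 : ℝ) / 32) (by norm_num)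
  rw [log_pow]
  push_cast
  linarith

lemma abs_jacSum_le_of_four_small {X : ℝ} (hX : 1 ≤ X) (hℓ : 1 ≤ log X) {P : Fin 6 → Finset ℕ}
    (hP : ∀ i, ∀ x ∈ P i, x ∈ Finset.Icc 1 ⌊X⌋₊) (k : Fin 6) (j : Fin 5)
    (hs : ∀ i : Fin 4, ∀ x ∈ P (k.succAbove (j.succAbove i)), (x : ℝ) ≤ log X ^ 500) :
    |jacSum X P| ≤ 2 * 2287 ^ 4 * X * log X ^ ((15 : ℝ) / 8) := by
  have hX0 : 0 < X := by linarith
  have hℓ0 : 0 < log X := by linarith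
  have hpos : ∀ i, ∀ x ∈ P i, 1 ≤ x := fun i x hx => (Finset.mem_Icc.1 (hP i x hx)).1
  refine (abs_jacSum_le_trivial hX0.le hpos k).trans ?_
  rw [Fin.prod_univ_succAbove _ j]
  have h1 : recipSum (P (k.succAbove j)) ≤ 2 * log X := by
    have := recipSum_le_of_le (P := P (k.succAbove j)) hX (fun x hx =>
      ⟨hpos _ x hx, (Nat.le_floor_iff hX0.le).1 (Finset.mem_Icc.1 (hP _ x hx)).2⟩)
    linarith
  have h2 : ∀ i : Fin 4, recipSum (P (k.succAbove (j.succAbove i))) ≤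
      2287 * log X ^ ((7 : ℝ) / 32) := fun i =>
    (recipSum_le_of_le (one_le_pow₀ hℓ) fun x hx => ⟨hpos _ x hx, hs i x hx⟩).trans
      (one_add_log_pow_le hℓ)
  calc _ ≤ X * ((2 * log X) * ∏ i : Fin 4, (2287 * log X ^ ((7 : ℝ) / 32))) := by
        gcongr
        · exact Finset.prod_nonneg fun _ _ => recipSum_nonneg _
        · exact fun _ _ => recipSum_nonneg _
        · exact h2 _
    _ = 2 * 2287 ^ 4 * X * (log X * (log X ^ ((7 : ℝ) / 32)) ^ 4) := by
        rw [Finset.prod_const, Finset.card_univ, Fintype.card_fin]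
        ring
    _ = _ := by
        congr 1
        rw [← rpow_natCast, ← rpow_mul hℓ0.le]
        nth_rewrite 1 [← rpow_one (log X)]
        rw [← rpow_add hℓ0]
        norm_num

lemma linear_bound_le {X : ℝ} (hX : 0 ≤ X) (hℓ : 1 ≤ log X) :
    2 * (24 * (log X ^ 96) ^ 2) * X / √(log X ^ 500) * (1 + log X) ^ 10 ≤ 49152 * X := by
  have hℓ0 : 0 < log X := by linarith
  have e : √(log X ^ 500) = log X ^ 250 := by
    rw [show log X ^ 500 = (log X ^ 250) ^ 2 by ring]
    exact sqrt_sq (by positivity)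
  rw [e]
  calc _ ≤ 2 * (24 * (log X ^ 96) ^ 2) * X / log X ^ 250 * (2 * log X) ^ 10 := by
        gcongr
        linarith
    _ = 49152 * X / log X ^ 48 := by
        field_simp
        ring
    _ ≤ 49152 * X := div_le_self (by positivity) (one_le_pow₀ hℓ)

lemma abs_jacSum_sizeClass_le {X : ℝ} (hX : 1 ≤ X) (hℓ : 1 ≤ log X) (b : Fin 6 → Fin 3) :
    |jacSum X (fun i => (Finset.Icc 2 ⌊X⌋₊).filter
      (fun x => sizeClass (log X ^ 96) (log X ^ 500) x = b i))| ≤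
      2 * 2287 ^ 4 * X * log X ^ ((15 : ℝ) / 8) := by
  have hX0 : 0 < X := by linarith
  have huv : log X ^ 96 ≤ log X ^ 500 := pow_le_pow_right₀ hℓ (by norm_num)
  have hpow : 1 ≤ log X ^ ((15 : ℝ) / 8) := one_le_rpow hℓ (by norm_num)
  set P : Fin 6 → Finset ℕ := fun i => (Finset.Icc 2 ⌊X⌋₊).filter
      (fun x => sizeClass (log X ^ 96) (log X ^ 500) x = b i) with hPdef
  have hmem : ∀ i x, x ∈ P i ↔ (2 ≤ x ∧ x ≤ ⌊X⌋₊) ∧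
      sizeClass (log X ^ 96) (log X ^ 500) x = b i := fun i x => by
    simp [hPdef]
  have hP : ∀ i, ∀ x ∈ P i, x ∈ Finset.Icc 1 ⌊X⌋₊ := fun i x hx => by
    have := (hmem i x).1 hx
    exact Finset.mem_Icc.2 ⟨by omega, this.1.2⟩
  have hpos : ∀ i, ∀ x ∈ P i, 0 < x := fun i x hx => (Finset.mem_Icc.1 (hP i x hx)).1
  have hlarge : ∀ i, b i = 2 → ∀ x, x ∈ P i ↔ x ∈ Finset.Icc 1 ⌊X⌋₊ ∧ log X ^ 500 < x := by
    intro i hi x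
    rw [hmem, hi, sizeClass_eq_two_iff huv, Finset.mem_Icc]
    constructor
    · rintro ⟨⟨h1, h2⟩, h3⟩
      exact ⟨⟨by omega, h2⟩, h3⟩
    · rintro ⟨⟨h1, h2⟩, h3⟩
      refine ⟨⟨?_, h2⟩, h3⟩
      have : (1 : ℝ) < x := (one_le_pow₀ hℓ).trans_lt h3
      exact_mod_cast this
  have hsmall : ∀ i, b i = 0 → ∀ x ∈ P i, 1 < x ∧ (x : ℝ) ≤ log X ^ 96 := by
    intro i hi x hx
    have := (hmem i x).1 hx
    exact ⟨this.1.1, sizeClass_eq_zero (this.2.trans hi)⟩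
  have hbig : ∀ i, b i ≠ 0 → ∀ x ∈ P i, log X ^ 96 < x := by
    intro i hi x hx
    exact lt_of_sizeClass_ne_zero (((hmem i x).1 hx).2 ▸ hi)
  have hlinked : ∀ i j : Fin 6, ((i = 0 ∧ j = 3) ∨ (i = 2 ∧ j = 1) ∨ (i = 4 ∧ j = 3) ∨
      (i = 0 ∧ j = 5) ∨ (i = 2 ∧ j = 5) ∨ (i = 4 ∧ j = 1)) → b i ≠ 0 → b j ≠ 0 →
      |jacSum X P| ≤ 2096 * X := by
    intro i j hij hi hj
    obtain ⟨σ, hσ, rfl, rfl⟩ := exists_symmetry_of_linked hij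
    exact abs_jacSum_le_of_linked hX0 hℓ hP hσ (hbig _ hi) (hbig _ hj)
  have hweak : ∀ {y : ℝ}, y ≤ 49152 * X → y ≤ 2 * 2287 ^ 4 * X * log X ^ ((15 : ℝ) / 8) := by
    intro y hy
    have : 2 * 2287 ^ 4 * X * 1 ≤ 2 * 2287 ^ 4 * X * log X ^ ((15 : ℝ) / 8) := by gcongr
    linarith
  have hb : b = ![b 0, b 1, b 2, b 3, b 4, b 5] := by
    ext i
    fin_cases i <;> rfl
  have hle : 2096 * X ≤ 49152 * X := by linarith
  rcases sizeClass_pattern (b 0) (b 1) (b 2) (b 3) (b 4) (b 5) with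
    h | h | h | h | h | h | ⟨k, j, h⟩ | h | h
  · exact hweak ((hlinked 0 3 (by decide) h.1 h.2).trans hle)
  · exact hweak ((hlinked 2 1 (by decide) h.1 h.2).trans hle)
  · exact hweak ((hlinked 4 3 (by decide) h.1 h.2).trans hle)
  · exact hweak ((hlinked 0 5 (by decide) h.1 h.2).trans hle)
  · exact hweak ((hlinked 2 5 (by decide) h.1 h.2).trans hle)
  · exact hweak ((hlinked 4 1 (by decide) h.1 h.2).trans hle)
  · rw [← hb] at h
    refine abs_jacSum_le_of_four_small hX hℓ hP k j fun i x hx => ?_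
    exact le_of_sizeClass_ne_two huv (((hmem _ x).1 hx).2 ▸ h i)
  · refine hweak ((abs_jacSum_le_of_linear hX (by positivity) (by positivity) hP 0
      (hlarge 0 h.1) fun s hs Z => ?_).trans (linear_bound_le hX0.le hℓ))
    rw [Fintype.mem_piFinset] at hs
    exact abs_sum_jacWeight_cons_le (fun i => hpos _ _ (hs i)) (hsmall 3 h.2.1 _ (hs 2))
      (hsmall 5 h.2.2 _ (hs 4)) Z
  · refine hweak ((abs_jacSum_le_of_linear hX (by positivity) (by positivity) hP 1
      (hlarge 1 h.1) fun s hs Z => ?_).trans (linear_bound_le hX0.le hℓ))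
    rw [Fintype.mem_piFinset] at hs
    exact abs_sum_jacWeight_insertNth_one_le (fun i => hpos _ _ (hs i)) (hsmall 2 h.2.1 _ (hs 1))
      (hsmall 4 h.2.2 _ (hs 3)) Z

lemma abs_jacSum_Icc_le {X : ℝ} (hX : 1 ≤ X) (hℓ : 1 ≤ log X) :
    |jacSum X (fun _ => Finset.Icc 2 ⌊X⌋₊)| ≤
      729 * (2 * 2287 ^ 4) * X * log X ^ ((15 : ℝ) / 8) := by
  rw [jacSum_eq_sum_sizeClass X _ (sizeClass (log X ^ 96) (log X ^ 500))]
  refine (Finset.abs_sum_le_sum_abs _ _).trans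
    ((Finset.sum_le_card_nsmul _ _ _ fun b _ => abs_jacSum_sizeClass_le hX hℓ b).trans
      (le_of_eq ?_))
  rw [nsmul_eq_mul, Finset.card_univ, Fintype.card_fun, Fintype.card_fin, Fintype.card_fin]
  push_cast
  ring

theorem jacobi_sixfold_character_sum_bound :
    ∃ C : ℝ, 0 < C ∧ ∃ X0 : ℝ, 3 ≤ X0 ∧
      ∀ X : ℝ, X0 ≤ X →
        |∑ t ∈ (Finset.Icc 2 ⌊X⌋₊) ×ˢ (Finset.Icc 2 ⌊X⌋₊) ×ˢ (Finset.Icc 2 ⌊X⌋₊) ×ˢ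
              (Finset.Icc 2 ⌊X⌋₊) ×ˢ (Finset.Icc 2 ⌊X⌋₊) ×ˢ (Finset.Icc 2 ⌊X⌋₊),
            (fun (x11 x12 x21 x22 x31 x32 : ℕ) =>
              if Squarefree (x11 * x12 * x21 * x22 * x31 * x32) ∧
                  ((x11 * x12 * x21 * x22 * x31 * x32 : ℕ) : ℝ) ≤ X then
                ((jacobiSym ((x21 * x22 * x31 * x32 : ℕ) : ℤ) x11 : ℤ) : ℝ) *
                  ((jacobiSym ((x11 * x12 * x31 * x32 : ℕ) : ℤ) x21 : ℤ) : ℝ) *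
                  ((jacobiSym ((x11 * x12 * x21 * x22 : ℕ) : ℤ) x31 : ℤ) : ℝ)
              else 0)
              t.1 t.2.1 t.2.2.1 t.2.2.2.1 t.2.2.2.2.1 t.2.2.2.2.2| ≤
          C * X * (Real.log X) ^ ((15 : ℝ) / 8) := by
  refine ⟨729 * (2 * 2287 ^ 4), by norm_num, 3, le_rfl, fun X hX => ?_⟩
  have hℓ : 1 ≤ log X := by
    rw [le_log_iff_exp_le (by linarith)]
    linarith [exp_one_lt_d9]
  refine le_of_eq_of_le (congrArg abs ?_) (abs_jacSum_Icc_le (by linarith) hℓ)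
  refine Finset.sum_bij'
    (fun t _ => ![t.1, t.2.1, t.2.2.1, t.2.2.2.1, t.2.2.2.2.1, t.2.2.2.2.2])
    (fun t _ => (t 0, t 1, t 2, t 3, t 4, t 5)) ?_ ?_ ?_ ?_ ?_
  · intro t ht
    simp only [Finset.mem_product] at ht
    rw [Fintype.mem_piFinset]
    intro i
    fin_cases i
    exacts [ht.1, ht.2.1, ht.2.2.1, ht.2.2.2.1, ht.2.2.2.2.1, ht.2.2.2.2.2]
  · intro t ht
    rw [Fintype.mem_piFinset] at ht
    simp only [Finset.mem_product]
    exact ⟨ht 0, ht 1, ht 2, ht 3, ht 4, ht 5⟩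
  · intro t _
    rfl
  · intro t _
    ext i
    fin_cases i <;> rfl
  · intro t _
    rw [jacTerm, prod_six, jacWeight_six]
    rfl
end

section
/- There exist constants B0 ≥ 1, C > 0 and X0 ≥ 16 such that for all X ≥ X0, the sum of d_3(n) over squarefree positive integers n ≤ X with ω(n) ≥ 30 * (log log X + B0) is at most C * X / (log X)^2. -/
open Real

/-- `d₃(n)`: the number of ordered triples `(a, b, c)` of positive integers with
`a * b * c = n`. -/
def d3 (n : ℕ) : ℕ := ∑ p ∈ n.divisorsAntidiagonal, p.2.divisors.card

open Finset ArithmeticFunction in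
/-- The summatory function of the iterated divisor function is at most `M * H_N ^ m`
for `M ≤ N`. -/
theorem sum_zeta_pow_succ_le (m : ℕ) {M N : ℕ} (hMN : M ≤ N) :
    ((∑ n ∈ Ioc 0 M, (zeta ^ (m + 1)) n : ℕ) : ℝ) ≤ M * (harmonic N : ℝ) ^ m := by
  induction m generalizing M with
  | zero =>
    have h : ∑ n ∈ Ioc 0 M, zeta n = M := by
      rw [sum_congr rfl fun n hn => zeta_apply_ne (mem_Ioc.1 hn).1.ne']
      simp
    rw [zero_add, pow_one, h, pow_zero, mul_one]
  | succ m ih =>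
    have hH : (harmonic N : ℝ) = ∑ n ∈ Icc 1 N, (n : ℝ)⁻¹ := by
      rw [harmonic_eq_sum_Icc]
      push_cast
      rfl
    have hH0 : (0 : ℝ) ≤ harmonic N := by
      rw [hH]
      positivity
    rw [pow_succ' zeta, sum_Ioc_mul_eq_sum_sum]
    calc ((∑ n ∈ Ioc 0 M, zeta n * ∑ k ∈ Ioc 0 (M / n), (zeta ^ (m + 1)) k : ℕ) : ℝ)
        = ∑ n ∈ Ioc 0 M, ((∑ k ∈ Ioc 0 (M / n), (zeta ^ (m + 1)) k : ℕ) : ℝ) := by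
          rw [Nat.cast_sum]
          refine sum_congr rfl fun n hn => ?_
          rw [zeta_apply_ne (mem_Ioc.1 hn).1.ne', one_mul]
      _ ≤ ∑ n ∈ Ioc 0 M, (M * (n : ℝ)⁻¹) * (harmonic N : ℝ) ^ m := by
          refine sum_le_sum fun n _ => (ih ((Nat.div_le_self M n).trans hMN)).trans ?_
          gcongr
          rw [← div_eq_mul_inv]
          exact Nat.cast_div_le
      _ ≤ ∑ n ∈ Icc 1 N, (M * (n : ℝ)⁻¹) * (harmonic N : ℝ) ^ m := by
          refine sum_le_sum_of_subset_of_nonneg (fun n hn => ?_) fun _ _ _ => by positivity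
          simp only [mem_Ioc, mem_Icc] at hn ⊢
          omega
      _ = M * (harmonic N : ℝ) ^ (m + 1) := by
          rw [← sum_mul, ← mul_sum, ← hH]
          ring

open ArithmeticFunction in
theorem zeta_pow_apply_prime (m : ℕ) {p : ℕ} (hp : p.Prime) : (zeta ^ m) p = m := by
  have h1 (k : ℕ) : (zeta ^ k) 1 = 1 := by
    induction k with
    | zero => simp
    | succ k ih => rw [pow_succ', zeta_mul_apply, Nat.divisors_one, Finset.sum_singleton, ih]
  induction m with
  | zero => simp [hp.ne_one]
  | succ m ih =>
    rw [pow_succ', zeta_mul_apply, hp.sum_divisors, ih, h1]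

open ArithmeticFunction in
theorem zeta_pow_apply_of_squarefree (m : ℕ) {n : ℕ} (hn : Squarefree n) :
    (zeta ^ m) n = m ^ n.primeFactors.card := by
  have hmul : (zeta ^ m).IsMultiplicative := by
    induction m with
    | zero => simp
    | succ m ih => rw [pow_succ]; exact ih.mul isMultiplicative_zeta
  rw [← hmul.prod_primeFactors hn]
  exact Finset.prod_eq_pow_card fun p hp =>
    zeta_pow_apply_prime m (Nat.prime_of_mem_primeFactors hp)

open ArithmeticFunction in
theorem d3_eq_zeta_pow (n : ℕ) : d3 n = (zeta ^ 3) n := by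
  rw [pow_succ', mul_apply]
  refine Finset.sum_congr rfl fun p hp => ?_
  rw [zeta_apply_ne (Nat.ne_zero_of_mem_divisorsAntidiagonal hp).1, one_mul, sq, zeta_mul_apply,
    Finset.sum_congr rfl fun i hi => zeta_apply_ne (Nat.pos_of_mem_divisors hi).ne']
  simp

theorem d3_many_prime_factors_sum_bound :
    ∃ B0 : ℝ, 1 ≤ B0 ∧ ∃ C : ℝ, 0 < C ∧ ∃ X0 : ℝ, 16 ≤ X0 ∧
      ∀ X : ℝ, X0 ≤ X →
        (∑ n ∈ Finset.Icc 1 ⌊X⌋₊,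
            if Squarefree n ∧
                30 * (Real.log (Real.log X) + B0) ≤ (n.primeFactors.card : ℝ) then
              (d3 n : ℝ)
            else 0) ≤ C * X / (Real.log X) ^ 2 := by
  refine ⟨1, le_rfl, 32, by norm_num, 16, le_rfl, fun X hX => ?_⟩
  have hlog : 1 ≤ Real.log X := by
    rw [Real.le_log_iff_exp_le (by linarith)]
    linarith [Real.exp_one_lt_d9]
  have hlog0 : 0 < Real.log X := by linarith
  have hL : 0 ≤ Real.log (Real.log X) := Real.log_nonneg hlog
  have hterm : ∀ n ∈ Finset.Icc 1 ⌊X⌋₊,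
      (if Squarefree n ∧ 30 * (Real.log (Real.log X) + 1) ≤ (n.primeFactors.card : ℝ) then
        (d3 n : ℝ) else 0) ≤
      ((Real.log X) ^ 7)⁻¹ * ((ArithmeticFunction.zeta ^ (5 + 1)) n : ℕ) := by
    intro n _
    split_ifs with h
    · obtain ⟨hsq, hcard⟩ := h
      rw [d3_eq_zeta_pow, zeta_pow_apply_of_squarefree _ hsq, zeta_pow_apply_of_squarefree _ hsq]
      have hpow : (Real.log X) ^ 7 ≤ 2 ^ n.primeFactors.card := by
        rw [← Real.log_le_log_iff (by positivity) (by positivity), Real.log_pow, Real.log_pow]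
        have := Real.log_two_gt_d9
        push_cast
        nlinarith
      push_cast
      rw [inv_mul_eq_div, le_div_iff₀ (by positivity)]
      calc (3 : ℝ) ^ n.primeFactors.card * Real.log X ^ 7
          ≤ 3 ^ n.primeFactors.card * 2 ^ n.primeFactors.card := by gcongr
        _ = 6 ^ n.primeFactors.card := by rw [← mul_pow]; norm_num
    · positivity
  have hH : (harmonic ⌊X⌋₊ : ℝ) ≤ 2 * Real.log X := by
    linarith [harmonic_floor_le_one_add_log X (by linarith)]
  have hH0 : (0 : ℝ) ≤ harmonic ⌊X⌋₊ :=
    (Real.log_nonneg (by linarith)).trans (log_le_harmonic_floor X (by linarith))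
  refine (Finset.sum_le_sum hterm).trans ?_
  rw [← Finset.mul_sum, ← Nat.cast_sum]
  calc ((Real.log X) ^ 7)⁻¹ *
        ((∑ n ∈ Finset.Ioc 0 ⌊X⌋₊, (ArithmeticFunction.zeta ^ (5 + 1)) n : ℕ) : ℝ)
      ≤ ((Real.log X) ^ 7)⁻¹ * (⌊X⌋₊ * (harmonic ⌊X⌋₊ : ℝ) ^ 5) := by
        gcongr
        exact sum_zeta_pow_succ_le 5 le_rfl
    _ ≤ ((Real.log X) ^ 7)⁻¹ * (X * (2 * Real.log X) ^ 5) := by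
        gcongr
        exact Nat.floor_le (by linarith)
    _ = 32 * X / (Real.log X) ^ 2 := by
        field_simp
        norm_num
end
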